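/- Suppose the structure on ℝ is d-minimal. Let M ⊆ ℝⁿ be a D^p submanifold and let ψ : M → ℝ be a positive definable function that is locally bounded from below by positive constants (for every x ∈ M there exist an open neighborhood U_x of x in M and c_x > 0 with ψ > c_x on U_x). Then there exists a positive definable C^p function φ : M → ℝ with φ ≤ ψ on M. -/

import Mathlib

open FirstOrder Set Filter Topology
open scoped Classical

noncomputable section

namespace DMinPaper

variable (L : FirstOrder.Language) [L.Structure ℝ]

/-- A subset of `ℝ^α` is definable (with parameters from `ℝ`) in the structure `L`. -/
def IsDef {α : Type} (s : Set (α → ℝ)) : Prop :=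
  (Set.univ : Set ℝ).Definable L s

/-- Definability of an `ℝ`-valued function on a subset `M ⊆ ℝ^α`, via its graph. -/
def IsDefFunOn {α : Type} (M : Set (α → ℝ)) (f : (α → ℝ) → ℝ) : Prop :=
  IsDef L {z : (α ⊕ Unit) → ℝ |
    (fun i => z (Sum.inl i)) ∈ M ∧ z (Sum.inr ()) = f (fun i => z (Sum.inl i))}

/-- Definability of a map `M → ℝ^β` on a subset `M ⊆ ℝ^α`, via its graph. -/
def IsDefMapOn {α β : Type} (M : Set (α → ℝ)) (f : (α → ℝ) → (β → ℝ)) : Prop :=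
  IsDef L {z : (α ⊕ β) → ℝ |
    (fun i => z (Sum.inl i)) ∈ M ∧ (fun j => z (Sum.inr j)) = f (fun i => z (Sum.inl i))}

/-- Definability of an `ℝ`-valued function on a subset of a product `ℝ^α × ℝ^β`. -/
def IsDefFun2On {α β : Type} (S : Set ((α → ℝ) × (β → ℝ)))
    (f : (α → ℝ) × (β → ℝ) → ℝ) : Prop :=
  IsDef L {z : ((α ⊕ β) ⊕ Unit) → ℝ |
    ((fun i => z (Sum.inl (Sum.inl i)), fun j => z (Sum.inl (Sum.inr j))) ∈ S) ∧
    z (Sum.inr ()) = f (fun i => z (Sum.inl (Sum.inl i)), fun j => z (Sum.inl (Sum.inr j)))}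

/-- Definability of a map into `ℝ^γ` on a subset of a product `ℝ^α × ℝ^β`. -/
def IsDefMap2On {α β γ : Type} (S : Set ((α → ℝ) × (β → ℝ)))
    (f : (α → ℝ) × (β → ℝ) → (γ → ℝ)) : Prop :=
  IsDef L {z : ((α ⊕ β) ⊕ γ) → ℝ |
    ((fun i => z (Sum.inl (Sum.inl i)), fun j => z (Sum.inl (Sum.inr j))) ∈ S) ∧
    (fun l => z (Sum.inr l)) = f (fun i => z (Sum.inl (Sum.inl i)), fun j => z (Sum.inl (Sum.inr j)))}

/-- Definability of a function `ℝ → ℝ`, via its graph. -/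
def IsDefFunR (f : ℝ → ℝ) : Prop :=
  IsDef L {z : Fin 2 → ℝ | z 1 = f (z 0)}

/-- The structure expands the ordered field of real numbers: the order, addition and
multiplication are definable. -/
def ExpandsOrderedField : Prop :=
  IsDef L {x : Fin 2 → ℝ | x 0 < x 1} ∧
  IsDef L {x : Fin 3 → ℝ | x 2 = x 0 + x 1} ∧
  IsDef L {x : Fin 3 → ℝ | x 2 = x 0 * x 1}

/-- A discrete subset of `ℝ`. -/
def IsDiscreteSet (D : Set ℝ) : Prop :=
  ∀ x ∈ D, ∃ U : Set ℝ, IsOpen U ∧ U ∩ D = {x}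

/-- d-minimality: the structure expands the ordered field of reals, and in every definable
family of subsets of `ℝ` each fiber is the union of an open set and `N` discrete sets, where
`N` does not depend on the parameter. -/
def DMinimal : Prop :=
  ExpandsOrderedField L ∧
  ∀ (k : ℕ) (S : Set ((Fin k ⊕ Unit) → ℝ)), IsDef L S →
    ∃ N : ℕ, ∀ a : Fin k → ℝ,
      ∃ (U : Set ℝ) (D : Fin N → Set ℝ),
        IsOpen U ∧ (∀ i, IsDiscreteSet (D i)) ∧
        {t : ℝ | Sum.elim a (fun _ => t) ∈ S} = U ∪ ⋃ i, D i

variable {E F : Type} [NormedAddCommGroup E] [NormedSpace ℝ E]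
  [NormedAddCommGroup F] [NormedSpace ℝ F]

/-- `f` is of class `C^p` on `M` (as a function on the submanifold `M`): near each point of `M`
it coincides on `M` with a `C^p` function defined on an ambient open set. -/
def CpOn (p : ℕ) (f : E → F) (M : Set E) : Prop :=
  ∀ x ∈ M, ∃ (U : Set E) (g : E → F),
    IsOpen U ∧ x ∈ U ∧ ContDiffOn ℝ p g U ∧ Set.EqOn f g (M ∩ U)

/-- The tangent vectors to `M` at `x`: velocities of differentiable curves through `x`
staying in `M`. -/
def TangentVecs (M : Set E) (x : E) : Set E :=
  {v | ∃ γ : ℝ → E, γ 0 = x ∧ (∀ᶠ t in 𝓝 (0:ℝ), γ t ∈ M) ∧ HasDerivAt γ v 0}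

/-- The differential of `f : M → N` at `x` is surjective onto the tangent space of `N`
at `f x`. -/
def SubmersionAtOn (f : E → F) (M : Set E) (N : Set F) (x : E) : Prop :=
  ∀ w ∈ TangentVecs N (f x), ∃ (γ : ℝ → E) (v : E),
    γ 0 = x ∧ (∀ᶠ t in 𝓝 (0:ℝ), γ t ∈ M) ∧ HasDerivAt γ v 0 ∧
    HasDerivAt (fun t => f (γ t)) w 0

/-- `x` is a critical point of `f : M → ℝ`: the differential of `f` at `x` vanishes on all
tangent vectors of `M` at `x`. -/
def IsCritPtOn (f : E → ℝ) (M : Set E) (x : E) : Prop :=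
  x ∈ M ∧ ∀ (γ : ℝ → E) (v : E), γ 0 = x → (∀ᶠ t in 𝓝 (0:ℝ), γ t ∈ M) →
    HasDerivAt γ v 0 → HasDerivAt (fun t => f (γ t)) 0 0

/-- `x` is a nondegenerate critical point of `f : M → ℝ` on the `d`-dimensional submanifold
`M`: in a local `C²` parametrization `ψ` of `M` at `x`, the Hessian of `f ∘ ψ` is a
nondegenerate bilinear form. -/
def IsNondegCritPtOn (f : E → ℝ) (M : Set E) (d : ℕ) (x : E) : Prop :=
  IsCritPtOn f M x ∧
  ∃ (W : Set (Fin d → ℝ)) (ψ : (Fin d → ℝ) → E) (w0 : Fin d → ℝ),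
    IsOpen W ∧ w0 ∈ W ∧ ContDiffOn ℝ 2 ψ W ∧ ψ w0 = x ∧ Set.MapsTo ψ W M ∧
    Function.Injective (fun u => fderiv ℝ ψ w0 u) ∧
    ∀ v : Fin d → ℝ, v ≠ 0 → ∃ w : Fin d → ℝ,
      iteratedFDeriv ℝ 2 (fun z => f (ψ z)) w0 ![v, w] ≠ 0

/-- `f` is a Morse function on the `d`-dimensional submanifold `M`: all critical points are
nondegenerate and distinct critical points have distinct critical values. -/
def IsMorseOn (f : E → ℝ) (M : Set E) (d : ℕ) : Prop :=
  (∀ x, IsCritPtOn f M x → IsNondegCritPtOn f M d x) ∧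
  ∀ x y, IsCritPtOn f M x → IsCritPtOn f M y → x ≠ y → f x ≠ f y

/-- `M ⊆ ℝⁿ` is a definable `C^p` submanifold of dimension `d`: `M` is definable and every
point of `M` has a definable `C^p` chart of `ℝⁿ` flattening `M` onto `ℝ^d × {0}`. -/
def IsDpSubmanifold (p : ℕ) {n : ℕ} (d : ℕ) (M : Set (Fin n → ℝ)) : Prop :=
  IsDef L M ∧ d ≤ n ∧
  ∀ x ∈ M, ∃ (U V : Set (Fin n → ℝ)) (φ ψ : (Fin n → ℝ) → (Fin n → ℝ)),
    IsOpen U ∧ x ∈ U ∧ IsOpen V ∧ (0 : Fin n → ℝ) ∈ V ∧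
    IsDef L U ∧ IsDef L V ∧ IsDefMapOn L U φ ∧ IsDefMapOn L V ψ ∧
    ContDiffOn ℝ p φ U ∧ ContDiffOn ℝ p ψ V ∧
    Set.MapsTo φ U V ∧ Set.MapsTo ψ V U ∧
    (∀ y ∈ U, ψ (φ y) = y) ∧ (∀ y ∈ V, φ (ψ y) = y) ∧
    φ x = 0 ∧ φ '' (M ∩ U) = V ∩ {y | ∀ i : Fin n, d ≤ (i : ℕ) → y i = 0}

/-- The definable set `X ⊆ ℝⁿ` has dimension at least `d`: some projection of `X` onto `d`
of the coordinates has nonempty interior. -/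
def hasDimGE {n : ℕ} (X : Set (Fin n → ℝ)) (d : ℕ) : Prop :=
  ∃ ι : Fin d → Fin n, StrictMono ι ∧ (interior ((fun x => fun i => x (ι i)) '' X)).Nonempty

/-- The dimension of `X ⊆ ℝⁿ`: the largest `d` such that some coordinate projection of `X`
onto `ℝ^d` has nonempty interior; `⊥` (i.e. `-∞`) for the empty set. -/
noncomputable def dimDef {n : ℕ} (X : Set (Fin n → ℝ)) : WithBot ℕ :=
  if X.Nonempty then ((sSup {d : ℕ | hasDimGE X d} : ℕ) : WithBot ℕ) else ⊥

/-- The coordinate projection `ℝⁿ → ℝ^d` determined by `ι`. -/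
def projc {n d : ℕ} (ι : Fin d → Fin n) (x : Fin n → ℝ) : Fin d → ℝ := fun i => x (ι i)

/-- An open box in `ℝⁿ`: a product of `n` nonempty open intervals. -/
def IsOpenBox {n : ℕ} (U : Set (Fin n → ℝ)) : Prop :=
  ∃ a b : Fin n → ℝ, (∀ i, a i < b i) ∧ U = Set.univ.pi fun i => Set.Ioo (a i) (b i)

/-- `M` is locally, at `x`, the image of a definable `C^p` section `τ` of the coordinate
projection `projc ι`. -/
def MultiGraphPtAt (p : ℕ) {n d : ℕ} (ι : Fin d → Fin n) (M : Set (Fin n → ℝ))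
    (x : Fin n → ℝ) : Prop :=
  ∃ U : Set (Fin n → ℝ), IsOpenBox U ∧ x ∈ U ∧
    ∃ τ : (Fin d → ℝ) → (Fin n → ℝ),
      IsDefMapOn L (projc ι '' U) τ ∧ ContDiffOn ℝ p τ (projc ι '' U) ∧
      M ∩ U = τ '' (projc ι '' U) ∧ ∀ z ∈ projc ι '' U, projc ι (τ z) = z

/-- A `D^p` multi-valued graph with respect to the coordinate projection `projc ι`. -/
def IsMultiGraph (p : ℕ) {n d : ℕ} (ι : Fin d → Fin n) (M : Set (Fin n → ℝ)) : Prop :=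
  IsDpSubmanifold L p d M ∧ ∀ x ∈ M, MultiGraphPtAt L p ι M x

/-- The gradient vector `(∂g/∂x₁, …, ∂g/∂x_d)` of `g : ℝ^d → ℝ` at `z`. -/
noncomputable def gradVec {d : ℕ} (g : (Fin d → ℝ) → ℝ) (z : Fin d → ℝ) : Fin d → ℝ :=
  fun i => fderiv ℝ g z (Pi.single i 1)

/-- The Hessian matrix `(∂²g/∂x_i∂x_j)` of `g : ℝ^d → ℝ` at `z`. -/
noncomputable def hessMat {d : ℕ} (g : (Fin d → ℝ) → ℝ) (z : Fin d → ℝ) :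
    Matrix (Fin d) (Fin d) ℝ :=
  Matrix.of fun i j => fderiv ℝ (fun w => fderiv ℝ g w (Pi.single j 1)) z (Pi.single i 1)

/-- The derivative of `f : M → ℝ` at `x` along the vector field `D`: the common value of
`d_x g (D x)` over all local `C¹` extensions `g` of `f` (and `0` if there is no such common
value). -/
noncomputable def vderiv (M : Set E) (D : E → E) (f : E → ℝ) (x : E) : ℝ :=
  if h : ∃ w : ℝ, ∀ (U : Set E) (g : E → ℝ), IsOpen U → x ∈ U → ContDiffOn ℝ 1 g U →
      Set.EqOn f g (M ∩ U) → fderiv ℝ g x (D x) = w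
  then h.choose else 0

/-- Iterated derivative `D_{α₁} ⋯ D_{α_m} f` of `f : M → ℝ` along a finite family of vector
fields, indexed by a list `α`. -/
noncomputable def vderivIter {k : ℕ} (M : Set E) (D : Fin k → E → E) :
    List (Fin k) → (E → ℝ) → E → ℝ
  | [], f => f
  | i :: l, f => vderiv M (D i) (vderivIter M D l f)

set_option linter.all false

/-- d-minimality as a class. -/
class DMin (L : FirstOrder.Language) [L.Structure ℝ] : Prop where
  h : DMinimal L

section infra
variable {L : FirstOrder.Language} [L.Structure ℝ] {α β γ : Type}

/-- Definable predicate. -/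
def DP (L : FirstOrder.Language) [L.Structure ℝ] {α : Type} (P : (α → ℝ) → Prop) : Prop :=
  IsDef L {v | P v}

/-- Definable function. -/
def DF (L : FirstOrder.Language) [L.Structure ℝ] {α : Type} (f : (α → ℝ) → ℝ) : Prop :=
  (Set.univ : Set ℝ).DefinableFun L f

theorem DP.congr {P Q : (α → ℝ) → Prop} (h : DP L P) (e : ∀ v, P v ↔ Q v) : DP L Q := by
  have : P = Q := funext fun v => propext (e v)
  rwa [← this]

theorem DP.and {P Q : (α → ℝ) → Prop} (hP : DP L P) (hQ : DP L Q) : DP L fun v => P v ∧ Q v :=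
  Definable.inter hP hQ
theorem DP.or {P Q : (α → ℝ) → Prop} (hP : DP L P) (hQ : DP L Q) : DP L fun v => P v ∨ Q v :=
  Definable.union hP hQ
theorem DP.not {P : (α → ℝ) → Prop} (hP : DP L P) : DP L fun v => ¬ P v :=
  Definable.compl hP
theorem DP.imp {P Q : (α → ℝ) → Prop} (hP : DP L P) (hQ : DP L Q) : DP L fun v => P v → Q v :=
  (hP.not.or hQ).congr fun v => by tauto
theorem DP.iff {P Q : (α → ℝ) → Prop} (hP : DP L P) (hQ : DP L Q) : DP L fun v => (P v ↔ Q v) :=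
  ((hP.imp hQ).and (hQ.imp hP)).congr fun v => by tauto
theorem DP.const (P : Prop) : DP L fun _ : α → ℝ => P := by
  by_cases h : P
  · exact DP.congr (P := fun _ => True) (definable_univ (L := L) (A := (univ : Set ℝ)) (α := α))
      fun v => by simp [h]
  · exact DP.congr (P := fun _ => False) (definable_empty (L := L) (A := (univ : Set ℝ)) (α := α))
      fun v => by simp [h]
theorem DP.exV [Finite β] {Q : (α → ℝ) → (β → ℝ) → Prop}
    (h : DP L fun w : α ⊕ β → ℝ => Q (fun i => w (Sum.inl i)) (fun j => w (Sum.inr j))) :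
    DP L fun v => ∃ x : β → ℝ, Q v x :=
  Definable.exists_of_finite h
theorem DP.allV [Finite β] {Q : (α → ℝ) → (β → ℝ) → Prop}
    (h : DP L fun w : α ⊕ β → ℝ => Q (fun i => w (Sum.inl i)) (fun j => w (Sum.inr j))) :
    DP L fun v => ∀ x : β → ℝ, Q v x :=
  Definable.forall_of_finite h
theorem DP.ex {Q : (α → ℝ) → ℝ → Prop}
    (h : DP L fun w : α ⊕ Unit → ℝ => Q (fun i => w (Sum.inl i)) (w (Sum.inr ()))) :
    DP L fun v => ∃ x : ℝ, Q v x :=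
  (DP.exV (Q := fun v (x : Unit → ℝ) => Q v (x ())) h).congr fun v =>
    ⟨fun ⟨x, hx⟩ => ⟨_, hx⟩, fun ⟨x, hx⟩ => ⟨fun _ => x, hx⟩⟩
theorem DP.all {Q : (α → ℝ) → ℝ → Prop}
    (h : DP L fun w : α ⊕ Unit → ℝ => Q (fun i => w (Sum.inl i)) (w (Sum.inr ()))) :
    DP L fun v => ∀ x : ℝ, Q v x :=
  (DP.allV (Q := fun v (x : Unit → ℝ) => Q v (x ())) h).congr fun v =>
    ⟨fun h x => h fun _ => x, fun h x => h _⟩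
theorem DP.allF {ι : Type*} [Finite ι] {Q : ι → (α → ℝ) → Prop} (h : ∀ i, DP L (Q i)) :
    DP L fun v => ∀ i, Q i v := by
  have := definable_iInter_of_finite (L := L) (A := (univ : Set ℝ)) (f := fun i => {v | Q i v}) h
  refine DP.congr (P := fun v => v ∈ ⋂ i, {v | Q i v}) this fun v => by simp
theorem DP.exF {ι : Type*} [Finite ι] {Q : ι → (α → ℝ) → Prop} (h : ∀ i, DP L (Q i)) :
    DP L fun v => ∃ i, Q i v :=
  (DP.allF fun i => (h i).not).not.congr fun v => by push Not; rfl

theorem DP.comp [Finite β] {P : (β → ℝ) → Prop} (hP : DP L P) {f : (α → ℝ) → β → ℝ}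
    (hf : ∀ j, DF L fun v => f v j) : DP L fun v => P (f v) :=
  Definable.preimage_map (S := {v | P v}) (F := f) hf hP
theorem DP.mem [Finite β] {S : Set (β → ℝ)} (hS : IsDef L S) {f : (α → ℝ) → β → ℝ}
    (hf : ∀ j, DF L fun v => f v j) : DP L fun v => f v ∈ S :=
  Definable.preimage_map (F := f) hf hS
theorem DF.comp [Finite β] {g : (β → ℝ) → ℝ} (hg : DF L g) {f : (α → ℝ) → β → ℝ}
    (hf : ∀ j, DF L fun v => f v j) : DF L fun v => g (f v) :=
  DefinableFun.comp hf hg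
theorem DF.var (i : α) : DF L fun v : α → ℝ => v i := DefinableFun.proj L
theorem DF.const (c : ℝ) : DF L fun _ : α → ℝ => c := L.definableFun_const α (mem_univ c)
theorem DP.eq {f g : (α → ℝ) → ℝ} (hf : DF L f) (hg : DF L g) : DP L fun v => f v = g v :=
  DefinableFun.ofPred_eq hf hg
theorem DF.of {f : (α → ℝ) → ℝ}
    (h : DP L fun w : α ⊕ Unit → ℝ => w (Sum.inr ()) = f (fun i => w (Sum.inl i))) : DF L f := by
  have := Definable.preimage_comp
    (Sum.elim (fun i => some i) (fun _ => none) : α ⊕ Unit → Option α) h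
  refine DP.congr (α := Option α) this fun v => ?_
  simp [Function.tupleGraph, Function.comp_def]
  exact eq_comm
theorem DF.graph [Finite α] {f : (α → ℝ) → ℝ} (h : DF L f) :
    DP L fun w : α ⊕ Unit → ℝ => w (Sum.inr ()) = f (fun i => w (Sum.inl i)) :=
  DP.eq (DF.var _) (h.comp fun _ => DF.var _)

variable [DMin L]
theorem DP.lt {f g : (α → ℝ) → ℝ} (hf : DF L f) (hg : DF L g) : DP L fun v => f v < g v := by
  have h := (DMin.h (L := L)).1.1
  refine DP.congr (DP.mem h (f := fun v => ![f v, g v]) ?_) fun v => by simp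
  intro j; fin_cases j <;> simpa
theorem DP.le {f g : (α → ℝ) → ℝ} (hf : DF L f) (hg : DF L g) : DP L fun v => f v ≤ g v :=
  (DP.lt hg hf).not.congr fun v => not_lt
theorem DF.add [Finite α] {f g : (α → ℝ) → ℝ} (hf : DF L f) (hg : DF L g) :
    DF L fun v => f v + g v := by
  have h := (DMin.h (L := L)).1.2.1
  refine DF.of (DP.congr (DP.mem h (f := fun w : α ⊕ Unit → ℝ =>
    ![f fun i => w (Sum.inl i), g fun i => w (Sum.inl i), w (Sum.inr ())]) ?_) fun v => by simp)
  intro j; fin_cases j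
  · exact hf.comp fun _ => DF.var _
  · exact hg.comp fun _ => DF.var _
  · exact DF.var _
theorem DF.mul [Finite α] {f g : (α → ℝ) → ℝ} (hf : DF L f) (hg : DF L g) :
    DF L fun v => f v * g v := by
  have h := (DMin.h (L := L)).1.2.2
  refine DF.of (DP.congr (DP.mem h (f := fun w : α ⊕ Unit → ℝ =>
    ![f fun i => w (Sum.inl i), g fun i => w (Sum.inl i), w (Sum.inr ())]) ?_) fun v => by simp)
  intro j; fin_cases j
  · exact hf.comp fun _ => DF.var _
  · exact hg.comp fun _ => DF.var _
  · exact DF.var _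
theorem DF.congr {f g : (α → ℝ) → ℝ} (hf : DF L f) (e : ∀ v, f v = g v) : DF L g := by
  rwa [← funext e]
theorem DF.neg [Finite α] {f : (α → ℝ) → ℝ} (hf : DF L f) : DF L fun v => - f v :=
  ((DF.const (-1)).mul hf).congr fun v => by ring
theorem DF.sub [Finite α] {f g : (α → ℝ) → ℝ} (hf : DF L f) (hg : DF L g) :
    DF L fun v => f v - g v :=
  (hf.add hg.neg).congr fun v => by ring
theorem DF.ite {P : (α → ℝ) → Prop} {f g : (α → ℝ) → ℝ} (hP : DP L P)
    (hf : DF L f) (hg : DF L g) : DF L fun v => if P v then f v else g v :=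
  DefinableFun.ite hP hf hg
theorem DF.abs [Finite α] {f : (α → ℝ) → ℝ} (hf : DF L f) : DF L fun v => |f v| :=
  (DF.ite (DP.le (DF.const 0) hf) hf hf.neg).congr fun v => by
    split_ifs with h
    · rw [abs_of_nonneg h]
    · rw [abs_of_nonpos (by linarith)]
theorem DF.pow [Finite α] {f : (α → ℝ) → ℝ} (hf : DF L f) (k : ℕ) : DF L fun v => f v ^ k := by
  induction k with
  | zero => simpa using DF.const 1
  | succ k ih => simpa [pow_succ] using ih.mul hf
theorem DF.max [Finite α] {f g : (α → ℝ) → ℝ} (hf : DF L f) (hg : DF L g) :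
    DF L fun v => max (f v) (g v) :=
  (DF.ite (DP.le hf hg) hg hf).congr fun v => by simp [max_def]
theorem DF.min [Finite α] {f g : (α → ℝ) → ℝ} (hf : DF L f) (hg : DF L g) :
    DF L fun v => min (f v) (g v) :=
  (DF.ite (DP.le hf hg) hf hg).congr fun v => by simp [min_def]
theorem DF.sum [Finite α] {ι : Type*} (s : Finset ι) {f : ι → (α → ℝ) → ℝ}
    (hf : ∀ i, DF L (f i)) : DF L fun v => ∑ i ∈ s, f i v := by
  induction s using Finset.induction_on with
  | empty => simpa using DF.const 0
  | insert a s ha ih => simpa [Finset.sum_insert ha] using (hf a).add ih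
theorem DF.inv [Finite α] {f : (α → ℝ) → ℝ} (hf : DF L f) : DF L fun v => (f v)⁻¹ := by
  have hf' : DF L fun w : α ⊕ Unit → ℝ => f fun i => w (Sum.inl i) := hf.comp fun _ => DF.var _
  refine DF.of (DP.congr (((DP.eq hf' (DF.const 0)).and (DP.eq (DF.var (Sum.inr ()))
    (DF.const 0))).or (DP.eq (hf'.mul (DF.var (Sum.inr ()))) (DF.const 1))) fun v => ?_)
  by_cases h : f (fun i => v (Sum.inl i)) = 0
  · simp [h]
  · simp only [h, false_and, false_or]
    rw [mul_comm]; constructor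
    · exact fun e => eq_inv_of_mul_eq_one_left e
    · intro e; rw [e]; exact inv_mul_cancel₀ h
theorem DF.div [Finite α] {f g : (α → ℝ) → ℝ} (hf : DF L f) (hg : DF L g) :
    DF L fun v => f v / g v :=
  (hf.mul hg.inv).congr fun v => by rw [div_eq_mul_inv]
theorem DP.norm_lt [Finite α] {k : ℕ} {f g : (α → ℝ) → Fin k → ℝ} {r : (α → ℝ) → ℝ}
    (hf : ∀ j, DF L fun v => f v j) (hg : ∀ j, DF L fun v => g v j) (hr : DF L r) :
    DP L fun v => ‖f v - g v‖ < r v :=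
  ((DP.lt (DF.const 0) hr).and (DP.allF (ι := Fin k) fun i =>
    DP.lt ((hf i).sub (hg i)).abs hr)).congr fun v => by
      constructor
      · rintro ⟨h0, h⟩
        exact (pi_norm_lt_iff h0).2 fun i => h i
      · intro h
        have h0 := (norm_nonneg _).trans_lt h
        exact ⟨h0, fun i => (pi_norm_lt_iff h0).1 h i⟩
theorem DP.norm_le [Finite α] {k : ℕ} {f g : (α → ℝ) → Fin k → ℝ} {r : (α → ℝ) → ℝ}
    (hf : ∀ j, DF L fun v => f v j) (hg : ∀ j, DF L fun v => g v j) (hr : DF L r) :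
    DP L fun v => ‖f v - g v‖ ≤ r v :=
  ((DP.le (DF.const 0) hr).and (DP.allF (ι := Fin k) fun i =>
    DP.le ((hf i).sub (hg i)).abs hr)).congr fun v => by
      constructor
      · rintro ⟨h0, h⟩
        exact (pi_norm_le_iff_of_nonneg h0).2 fun i => h i
      · intro h
        have h0 := (norm_nonneg _).trans h
        exact ⟨h0, fun i => (pi_norm_le_iff_of_nonneg h0).1 h i⟩
theorem DF.sSup [Finite α] {S : (α → ℝ) → ℝ → Prop}
    (h : DP L fun w : α ⊕ Unit → ℝ => S (fun i => w (Sum.inl i)) (w (Sum.inr ()))) :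
    DF L fun v => sSup {t | S v t} := by
  have key : ∀ v s, s = SupSet.sSup {t | S v t} ↔
      (((∃ t, S v t) ∧ (∃ B, ∀ t, S v t → t ≤ B)) ∧
        (∀ t, S v t → t ≤ s) ∧ ∀ b, (∀ t, S v t → t ≤ b) → s ≤ b) ∨
      (¬ ((∃ t, S v t) ∧ (∃ B, ∀ t, S v t → t ≤ B)) ∧ s = 0) := by
    intro v s
    by_cases hc : (∃ t, S v t) ∧ (∃ B, ∀ t, S v t → t ≤ B)
    · simp only [hc, true_and, not_true_eq_false, false_and, or_false]
      have hl : IsLUB {t | S v t} (SupSet.sSup {t | S v t}) :=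
        isLUB_csSup hc.1 (by obtain ⟨B, hB⟩ := hc.2; exact ⟨B, fun t ht => hB t ht⟩)
      constructor
      · rintro rfl
        exact ⟨fun t ht => hl.1 ht, fun b hb => hl.2 hb⟩
      · rintro ⟨h1, h2⟩
        exact IsLUB.unique ⟨fun t ht => h1 t ht, fun b hb => h2 b hb⟩ hl
    · simp only [hc, false_and, not_false_eq_true, true_and, false_or]
      have : SupSet.sSup {t | S v t} = 0 := by
        by_cases h1 : ∃ t, S v t
        · refine Real.sSup_of_not_bddAbove fun ⟨B, hB⟩ => hc ⟨h1, B, fun t ht => hB ht⟩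
        · push Not at h1
          have : {t | S v t} = ∅ := by ext t; simp [h1 t]
          rw [this, Real.sSup_empty]
      rw [this]
  have hS : ∀ {δ : Type} [Finite δ] (f : (δ → ℝ) → α → ℝ) (g : (δ → ℝ) → ℝ),
      (∀ j, DF L fun v => f v j) → DF L g → DP L fun v => S (f v) (g v) := by
    intro δ _ f g hf hg
    exact DP.comp h (f := fun v => Sum.elim (f v) (fun _ => g v)) (by
      rintro (j | j)
      · exact hf j
      · exact hg)
  refine DF.of (DP.congr (P := _) ?_ fun v => (key _ _).symm)
  have hx : ∀ {δ : Type} [Finite δ] (f : (δ → ℝ) → α → ℝ), (∀ j, DF L fun v => f v j) →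
      DP L fun v => ((∃ t, S (f v) t) ∧ (∃ B, ∀ t, S (f v) t → t ≤ B)) := by
    intro δ _ f hf
    refine DP.and (DP.ex (hS _ _ (fun j => (hf j).comp fun _ => DF.var _) (DF.var _)))
      (DP.ex (DP.all (DP.imp (hS _ _ (fun j => (hf j).comp fun _ => DF.var _) (DF.var _))
        (DP.le (DF.var _) (DF.var _)))))
  refine DP.or (DP.and (hx _ fun _ => DF.var _) (DP.and (DP.all (DP.imp (hS _ _ (fun _ => DF.var _)
    (DF.var _)) (DP.le (DF.var _) (DF.var _)))) (DP.all (DP.imp (DP.all (DP.imp (hS _ _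
      (fun _ => DF.var _) (DF.var _)) (DP.le (DF.var _) (DF.var _)))) (DP.le (DF.var _)
      (DF.var _)))))) (DP.and (hx _ fun _ => DF.var _).not (DP.eq (DF.var _) (DF.const _)))

/-- membership in an interior is definable in families -/
theorem DP.nhds [Finite α] {k : ℕ} {Q : (α → ℝ) → (Fin k → ℝ) → Prop} {f : (α → ℝ) → Fin k → ℝ}
    (hf : ∀ j, DF L fun v => f v j)
    (h : DP L fun w : α ⊕ Fin k → ℝ => Q (fun i => w (Sum.inl i)) (fun j => w (Sum.inr j))) :
    DP L fun v => ∀ᶠ y in 𝓝 (f v), Q v y := by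
  have e : ∀ v, (∃ r : ℝ, 0 < r ∧ ∀ y : Fin k → ℝ, ‖y - f v‖ < r → Q v y) ↔
      ∀ᶠ y in 𝓝 (f v), Q v y := by
    intro v
    rw [Metric.eventually_nhds_iff]
    simp only [dist_eq_norm, gt_iff_lt]
  refine DP.congr ?_ e
  refine DP.ex (DP.and (DP.lt (DF.const _) (DF.var _)) (DP.allV (DP.imp (DP.norm_lt
    (fun _ => DF.var _) (fun j => (hf j).comp fun _ => DF.var _) (DF.var _)) ?_)))
  exact DP.comp h (f := fun w => Sum.elim (fun i => w (Sum.inl (Sum.inl i)))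
    (fun j => w (Sum.inr j))) (by rintro (j | j) <;> exact DF.var _)

theorem DP.closure [Finite α] {k : ℕ} {S : Set (Fin k → ℝ)} (hS : IsDef L S)
    {f : (α → ℝ) → Fin k → ℝ} (hf : ∀ j, DF L fun v => f v j) :
    DP L fun v => f v ∈ closure S := by
  refine (DP.nhds (Q := fun _ y => ¬ y ∈ S) hf (DP.mem hS fun _ => DF.var _).not).not.congr ?_
  intro v
  rw [mem_closure_iff_frequently]; rfl

end infra


section topo

/-- non-isolated points -/
def dset {E : Type*} [MetricSpace E] (A : Set E) : Set E :=
  {x | x ∈ A ∧ ∀ r : ℝ, 0 < r → ∃ x' ∈ A, x' ≠ x ∧ dist x' x < r}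

def Disc {E : Type*} [MetricSpace E] (D : Set E) : Prop :=
  ∀ x ∈ D, ∃ r : ℝ, 0 < r ∧ ∀ x' ∈ D, dist x' x < r → x' = x

variable {E : Type*} [MetricSpace E]

theorem dset_inter_open (A U : Set E) (hU : IsOpen U) : dset (A ∩ U) = dset A ∩ U := by
  ext x
  constructor
  · rintro ⟨⟨hA, hx⟩, h⟩
    exact ⟨⟨hA, fun r hr => by
      obtain ⟨x', h1, h2⟩ := h r hr
      exact ⟨x', h1.1, h2⟩⟩, hx⟩
  · rintro ⟨⟨hA, h⟩, hx⟩
    refine ⟨⟨hA, hx⟩, fun r hr => ?_⟩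
    obtain ⟨s, hs, hsU⟩ := Metric.isOpen_iff.1 hU x hx
    obtain ⟨x', h1, h2, h3⟩ := h (min r s) (lt_min hr hs)
    exact ⟨x', ⟨h1, hsU (h3.trans_le (min_le_right _ _))⟩, h2, h3.trans_le (min_le_left _ _)⟩

theorem dset_iter_inter_open (A U : Set E) (hU : IsOpen U) (N : ℕ) :
    dset^[N] (A ∩ U) = dset^[N] A ∩ U := by
  induction N with
  | zero => rfl
  | succ N ih => rw [Function.iterate_succ_apply', Function.iterate_succ_apply', ih,
      dset_inter_open _ _ hU]

theorem dset_sub (A : Set E) : dset A ⊆ A := fun _ h => h.1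

theorem dset_iter_sub (A : Set E) (N : ℕ) : dset^[N] A ⊆ A := by
  induction N with
  | zero => exact subset_rfl
  | succ N ih => rw [Function.iterate_succ_apply']; exact (dset_sub _).trans ih

theorem dset_iter_empty (N : ℕ) : ∀ (A : Set E) (D : Fin N → Set E), (∀ i, Disc (D i)) →
    A ⊆ ⋃ i, D i → dset^[N] A = ∅ := by
  induction N with
  | zero =>
    intro A D _ h
    simpa using h
  | succ N ih =>
    intro A D hD h
    by_contra hne
    obtain ⟨x, hx⟩ := Set.nonempty_iff_ne_empty.2 hne
    obtain ⟨i, hi⟩ := mem_iUnion.1 (h (dset_iter_sub _ _ hx))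
    obtain ⟨r, hr, hxr⟩ := hD i x hi
    rw [Function.iterate_succ_apply'] at hx
    obtain ⟨x', h1, h2, h3⟩ := hx.2 r hr
    have hV : IsOpen (Metric.ball x r \ {x}) := Metric.isOpen_ball.sdiff isClosed_singleton
    have := ih (A ∩ (Metric.ball x r \ {x})) (fun j => D (i.succAbove j)) (fun j => hD _) (by
      rintro y ⟨hyA, hy1, hy2⟩
      obtain ⟨j, hj⟩ := mem_iUnion.1 (h hyA)
      have hji : j ≠ i := by
        rintro rfl
        exact hy2 (hxr y hj hy1)
      obtain ⟨l, rfl⟩ := Fin.exists_succAbove_eq hji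
      exact mem_iUnion.2 ⟨l, hj⟩)
    rw [dset_iter_inter_open _ _ hV] at this
    have hm : x' ∈ dset^[N] A ∩ (Metric.ball x r \ {x}) := ⟨h1, h3, h2⟩
    rw [this] at hm
    exact hm

theorem baireL {X ι : Type*} [TopologicalSpace X] [BaireSpace X] [Countable ι] {V : Set X}
    (hV : IsOpen V) (hne : V.Nonempty) (S : ι → Set X) (h : V ⊆ ⋃ i, S i) :
    ∃ i, (interior (closure (S i)) ∩ V).Nonempty := by
  by_contra hc
  push Not at hc
  have hd : ∀ i, Dense (closure (S i) ∩ closure V)ᶜ := by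
    intro i
    rw [← interior_eq_empty_iff_dense_compl]
    by_contra hne
    rw [interior_inter] at hne
    obtain ⟨x, hx1, hx2⟩ := Set.nonempty_iff_ne_empty.2 hne
    have := mem_closure_iff.1 (interior_subset hx2) _ isOpen_interior hx1
    rw [hc i] at this
    exact Set.not_nonempty_empty this
  have hD := dense_iInter_of_isOpen (fun i => (isClosed_closure.inter isClosed_closure).isOpen_compl) hd
  obtain ⟨x, hxV, hx⟩ := hD.inter_open_nonempty V hV hne
  obtain ⟨i, hi⟩ := mem_iUnion.1 (h hxV)
  exact mem_iInter.1 hx i ⟨subset_closure hi, subset_closure hxV⟩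

theorem disc_not_dense {N : ℕ} {D : Fin N → Set ℝ} (hD : ∀ i, Disc (D i)) {V : Set ℝ}
    (hV : IsOpen V) (hne : V.Nonempty) (h : V ⊆ closure (⋃ i, D i)) : False := by
  rw [closure_iUnion_of_finite] at h
  obtain ⟨i, x, hx, hxV⟩ := baireL hV hne _ h
  rw [closure_closure] at hx
  obtain ⟨y, hy1, hy2⟩ := mem_closure_iff.1 (interior_subset hx) _ isOpen_interior hx
  obtain ⟨r, hr, hyr⟩ := hD i y hy2
  have ho : IsOpen (interior (closure (D i)) ∩ Metric.ball y r) := isOpen_interior.inter Metric.isOpen_ball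
  have : ∃ z ∈ interior (closure (D i)) ∩ Metric.ball y r, z ≠ y := by
    obtain ⟨s, hs, hsU⟩ := Metric.isOpen_iff.1 ho y ⟨hy1, Metric.mem_ball_self hr⟩
    refine ⟨y + s / 2, hsU ?_, by simp; linarith⟩
    simp [Real.dist_eq, abs_of_pos, hs]
  obtain ⟨z, hz, hzy⟩ := this
  obtain ⟨w, ⟨⟨hw1, hw2⟩, hw3⟩, hw4⟩ := mem_closure_iff.1 (interior_subset hz.1) _
    (ho.sdiff (isClosed_singleton (x := y))) ⟨hz, hzy⟩
  exact hw3 (hyr w hw4 hw2)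

theorem disc_countable {D : Set ℝ} (hD : Disc D) : D.Countable := by
  have : DiscreteTopology D := by
    rw [discreteTopology_subtype_iff']
    intro y hy
    obtain ⟨r, hr, h⟩ := hD y hy
    refine ⟨Metric.ball y r, Metric.isOpen_ball, ?_⟩
    ext z
    constructor
    · rintro ⟨h1, h2⟩; exact h z h2 h1
    · rintro rfl; exact ⟨Metric.mem_ball_self hr, hy⟩
  exact Set.countable_coe_iff.1 (TopologicalSpace.separableSpace_iff_countable.1 inferInstance)

end topo

section oned
variable {L : FirstOrder.Language} [L.Structure ℝ] [DMin L]

theorem isDiscreteSet_disc {D : Set ℝ} (h : IsDiscreteSet D) : Disc D := by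
  intro x hx
  obtain ⟨U, hU, e⟩ := h x hx
  have hxU : x ∈ U := by
    have : x ∈ U ∩ D := by rw [e]; rfl
    exact this.1
  obtain ⟨r, hr, hs⟩ := Metric.isOpen_iff.1 hU x hxU
  refine ⟨r, hr, fun x' h1 h2 => ?_⟩
  have : x' ∈ U ∩ D := ⟨hs h2, h1⟩
  rw [e] at this
  exact this

theorem fam_dmin {k : ℕ} {S : (Fin k → ℝ) → ℝ → Prop}
    (h : DP L fun w : Fin k ⊕ Unit → ℝ => S (fun i => w (Sum.inl i)) (w (Sum.inr ()))) :
    ∃ N : ℕ, ∀ a, ∃ (U : Set ℝ) (D : Fin N → Set ℝ), IsOpen U ∧ (∀ i, Disc (D i)) ∧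
      {t | S a t} = U ∪ ⋃ i, D i := by
  obtain ⟨N, hN⟩ := (DMin.h (L := L)).2 k _ h
  refine ⟨N, fun a => ?_⟩
  obtain ⟨U, D, h1, h2, h3⟩ := hN a
  exact ⟨U, D, h1, fun i => isDiscreteSet_disc (h2 i), h3⟩

theorem one_dmin {S : ℝ → Prop} (h : DP L fun v : Unit → ℝ => S (v ())) :
    ∃ (N : ℕ) (U : Set ℝ) (D : Fin N → Set ℝ), IsOpen U ∧ (∀ i, Disc (D i)) ∧
      {t | S t} = U ∪ ⋃ i, D i := by
  obtain ⟨N, hN⟩ := fam_dmin (L := L) (k := 0) (S := fun _ => S)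
    (DP.comp h (f := fun w _ => w (Sum.inr ())) fun _ => DF.var _)
  exact ⟨N, hN 0⟩

theorem one_interior {S : ℝ → Prop} (h : DP L fun v : Unit → ℝ => S (v ())) {I : Set ℝ}
    (hI : IsOpen I) (hne : I.Nonempty) (hd : I ⊆ closure {t | S t}) :
    (interior {t | S t} ∩ I).Nonempty := by
  obtain ⟨N, U, D, hU, hD, e⟩ := one_dmin h
  have hUi : U ⊆ interior {t | S t} := interior_maximal (by rw [e]; exact subset_union_left) hU
  by_contra hc
  rw [Set.not_nonempty_iff_eq_empty] at hc
  refine disc_not_dense hD hI hne fun x hx => ?_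
  have hx2 := hd hx
  rw [e, closure_union] at hx2
  rcases hx2 with hx2 | hx2
  · obtain ⟨y, hy1, hy2⟩ := mem_closure_iff.1 hx2 I hI hx
    have : y ∈ interior {t | S t} ∩ I := ⟨hUi hy2, hy1⟩
    rw [hc] at this
    exact this.elim
  · exact hx2

theorem one_small {S : ℝ → Prop} (h : DP L fun v : Unit → ℝ => S (v ()))
    (hi : interior {t | S t} = ∅) : {t | S t}.Countable ∧ ∃ N, dset^[N] {t | S t} = ∅ := by
  obtain ⟨N, U, D, hU, hD, e⟩ := one_dmin h
  have hUi : U ⊆ interior {t | S t} := interior_maximal (by rw [e]; exact subset_union_left) hU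
  rw [hi, subset_empty_iff] at hUi
  rw [hUi, empty_union] at e
  exact ⟨by rw [e]; exact countable_iUnion fun i => disc_countable (hD i),
    N, dset_iter_empty N _ D hD e.subset⟩

/-- definable somewhere dense sets have interior -/
theorem idense (k : ℕ) : ∀ {A : (Fin k → ℝ) → Prop}, DP L A → ∀ {B : Set (Fin k → ℝ)}, IsOpen B →
    B.Nonempty → B ⊆ closure {y | A y} → (interior {y | A y} ∩ B).Nonempty := by
  induction k with
  | zero =>
    intro A _ B hB hne hd
    obtain ⟨x, hx⟩ := hne
    obtain ⟨y, _, hy⟩ := mem_closure_iff.1 (hd hx) _ hB hx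
    have : {y | A y} = univ := by
      ext z; rw [Subsingleton.elim z y]; simpa using hy
    rw [this, interior_univ, univ_inter]
    exact ⟨x, hx⟩
  | succ k ih =>
    intro A hA B hB hne hd
    obtain ⟨x, hx⟩ := hne
    have hcc : Continuous fun p : ℝ × (Fin k → ℝ) => (Fin.cons p.1 p.2 : Fin (k+1) → ℝ) := by
      refine continuous_pi fun i => ?_
      refine Fin.cases ?_ (fun j => ?_) i
      · simpa using continuous_fst
      · simp only [Fin.cons_succ]
        fun_prop
    have hB' : {p : ℝ × (Fin k → ℝ) | (Fin.cons p.1 p.2 : Fin (k+1) → ℝ) ∈ B} ∈ 𝓝 (x 0, Fin.tail x) := by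
      refine (hB.preimage hcc).mem_nhds ?_
      simpa using hx
    obtain ⟨I, hI, V, hV, hIV⟩ := mem_nhds_prod_iff.1 hB'
    obtain ⟨V, hVs, hVo, hVx⟩ := mem_nhds_iff.1 hV
    obtain ⟨I, hIs, hIo, hIx⟩ := mem_nhds_iff.1 hI
    have hIV : ∀ t ∈ I, ∀ y ∈ V, (Fin.cons t y : Fin (k+1) → ℝ) ∈ B := fun t ht y hy =>
      hIV (Set.mk_mem_prod (hIs ht) (hVs hy))
    have hcA : ∀ {δ : Type} [Finite δ] (f : (δ → ℝ) → ℝ) (g : (δ → ℝ) → Fin k → ℝ), DF L f →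
        (∀ j, DF L fun v => g v j) → DP L fun v => A (Fin.cons (f v) (g v)) := by
      intro δ _ f g hf hg
      refine DP.comp hA (f := fun v => Fin.cons (f v) (g v)) fun j => ?_
      refine Fin.cases ?_ (fun j => ?_) j
      · simpa using hf
      · simpa using hg j
    -- the sets
    let AJ : ℚ × ℚ → (Fin k → ℝ) → Prop := fun q y => ∃ t : ℝ, ((q.1 : ℝ) < t ∧ t < q.2) ∧ A (Fin.cons t y)
    let CJ : ℚ × ℚ → (Fin k → ℝ) → Prop := fun q y => ∀ t : ℝ, ((q.1 : ℝ) < t ∧ t < q.2) → A (Fin.cons t y)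
    have dAJ : ∀ q, DP L (AJ q) := fun q => DP.ex (DP.and (DP.and (DP.lt (DF.const _) (DF.var _))
      (DP.lt (DF.var _) (DF.const _))) (hcA _ _ (DF.var _) fun _ => DF.var _))
    have dCJ : ∀ q, DP L (CJ q) := fun q => DP.all (DP.imp (DP.and (DP.lt (DF.const _) (DF.var _))
      (DP.lt (DF.var _) (DF.const _))) (hcA _ _ (DF.var _) fun _ => DF.var _))
    let S : (ℚ × ℚ) ⊕ (ℚ × ℚ) → Set (Fin k → ℝ) := Sum.elim
      (fun q => if (q.1 < q.2 ∧ Ioo (q.1 : ℝ) q.2 ⊆ I) then (interior {y | AJ q y})ᶜ else ∅)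
      (fun q => if (q.1 < q.2 ∧ Ioo (q.1 : ℝ) q.2 ⊆ I) then {y | CJ q y} else ∅)
    have hcov : V ⊆ ⋃ i, S i := by
      intro y hy
      by_contra hc
      simp only [mem_iUnion, not_exists] at hc
      have h1 : ∀ q : ℚ × ℚ, q.1 < q.2 → Ioo (q.1 : ℝ) q.2 ⊆ I → AJ q y := by
        intro q hq hqI
        have := hc (Sum.inl q)
        simp only [S, Sum.elim_inl, hq, hqI, and_self, if_true, mem_compl_iff, not_not] at this
        have h3 : y ∈ {y | AJ q y} := interior_subset this
        exact h3
      have h2 : ∀ q : ℚ × ℚ, q.1 < q.2 → Ioo (q.1 : ℝ) q.2 ⊆ I → ¬ CJ q y := by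
        intro q hq hqI
        have := hc (Sum.inr q)
        simp only [S, Sum.elim_inr, hq, hqI, and_self, if_true] at this
        exact fun hC => this hC
      have rat : ∀ (O : Set ℝ), IsOpen O → ∀ t ∈ O, ∃ q : ℚ × ℚ, q.1 < q.2 ∧ Ioo (q.1 : ℝ) q.2 ⊆ O ∧
          t ∈ Ioo (q.1 : ℝ) q.2 := by
        intro O hO t ht
        obtain ⟨r, hr, hs⟩ := Metric.isOpen_iff.1 hO t ht
        obtain ⟨q1, h1, h1'⟩ := exists_rat_btwn (show t - r < t by linarith)
        obtain ⟨q2, h2, h2'⟩ := exists_rat_btwn (show t < t + r by linarith)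
        refine ⟨(q1, q2), by exact_mod_cast h1'.trans h2, fun s hs' => hs ?_, h1', h2⟩
        rw [Metric.mem_ball, Real.dist_eq, abs_lt]
        simp only [mem_Ioo] at hs'
        constructor <;> linarith [hs'.1, hs'.2]
      have hdense : I ⊆ closure {t | A (Fin.cons t y)} := by
        intro t ht
        rw [mem_closure_iff]
        intro O hO htO
        obtain ⟨q, hq, hqs, -⟩ := rat (O ∩ I) (hO.inter hIo) t ⟨htO, ht⟩
        obtain ⟨s, hs, hsA⟩ := h1 q hq (hqs.trans inter_subset_right)
        exact ⟨s, (hqs hs).1, hsA⟩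
      obtain ⟨t, ht, htI⟩ := one_interior (L := L) (hcA (fun v => v ()) (fun _ => y) (DF.var _) fun j => DF.const _) hIo ⟨_, hIx⟩ hdense
      obtain ⟨q, hq, hqs, -⟩ := rat _ (isOpen_interior.inter hIo) t ⟨ht, htI⟩
      exact h2 q hq (hqs.trans inter_subset_right) fun s hs => by
        have h3 : s ∈ {t | A (Fin.cons t y)} := interior_subset (hqs hs).1
        exact h3
    obtain ⟨i, hi⟩ := baireL hVo ⟨_, hVx⟩ S hcov
    rcases i with q | q
    · simp only [S, Sum.elim_inl] at hi
      split_ifs at hi with hq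
      · exfalso
        rw [closure_compl, interior_interior, interior_compl] at hi
        obtain ⟨y0, hy0, hy0V⟩ := hi
        have hO : IsOpen ((closure (interior {y | AJ q y}))ᶜ ∩ V) :=
          isClosed_closure.isOpen_compl.inter hVo
        obtain ⟨y, hy1, hy2, hy3⟩ := ih (dAJ q) hO ⟨y0, hy0, hy0V⟩ (by
          rintro y ⟨-, hyV⟩
          rw [mem_closure_iff]
          intro O' hO' hyO'
          obtain ⟨t, ht⟩ := exists_between (show (q.1 : ℝ) < q.2 by exact_mod_cast hq.1)
          have hb := hd (hIV t (hq.2 ht) y hyV)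
          have hopen : IsOpen {z : Fin (k+1) → ℝ | z 0 ∈ Ioo (q.1 : ℝ) q.2 ∧ Fin.tail z ∈ O'} := by
            refine (isOpen_Ioo.preimage (continuous_apply 0)).inter (hO'.preimage ?_)
            exact continuous_pi fun j => continuous_apply _
          obtain ⟨z, hz1, hz2⟩ := mem_closure_iff.1 hb _ hopen ⟨by simpa using ht, by simpa using hyO'⟩
          refine ⟨Fin.tail z, hz1.2, z 0, hz1.1, ?_⟩
          simpa using hz2)
        exact hy2 (subset_closure hy1)
      · simp at hi
    · simp only [S, Sum.elim_inr] at hi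
      split_ifs at hi with hq
      · obtain ⟨y, hy1, hy2⟩ := ih (dCJ q) (isOpen_interior.inter hVo) hi
          (fun y hy => interior_subset hy.1)
        obtain ⟨t, ht⟩ := exists_between (show (q.1 : ℝ) < q.2 by exact_mod_cast hq.1)
        refine ⟨Fin.cons t y, ?_, hIV t (hq.2 ht) y hy2.2⟩
        have hopen : IsOpen {z : Fin (k+1) → ℝ | z 0 ∈ Ioo (q.1 : ℝ) q.2 ∧
            Fin.tail z ∈ interior {y | CJ q y}} := by
          refine (isOpen_Ioo.preimage (continuous_apply 0)).inter (isOpen_interior.preimage ?_)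
          exact continuous_pi fun j => continuous_apply _
        refine interior_maximal ?_ hopen ⟨by simpa using ht, by simpa using hy1⟩
        rintro z ⟨hz1, hz2⟩
        have := interior_subset hz2 (z 0) hz1
        simpa using this
      · simp at hi

/-- Baire for definable sets. -/
theorem baireD {k : ℕ} {ι : Type*} [Countable ι] {V : Set (Fin k → ℝ)} (hV : IsOpen V)
    (hne : V.Nonempty) (S : ι → (Fin k → ℝ) → Prop) (hS : ∀ i, DP L (S i))
    (h : V ⊆ ⋃ i, {y | S i y}) : ∃ i, (interior {y | S i y} ∩ V).Nonempty := by
  obtain ⟨i, hi⟩ := baireL hV hne _ h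
  obtain ⟨y, hy1, hy2⟩ := idense (L := L) k (hS i) (isOpen_interior.inter hV) hi
    fun y hy => interior_subset hy.1
  exact ⟨i, y, hy1, hy2.2⟩

theorem dense_interior {k : ℕ} {S : (Fin k → ℝ) → Prop} (hS : DP L S) (hd : Dense {y | S y}) :
    Dense (interior {y | S y}) := by
  rw [dense_iff_inter_open]
  intro U hU hne
  obtain ⟨y, h1, h2⟩ := idense (L := L) k hS hU hne fun y _ => hd y
  exact ⟨y, h2, h1⟩

end oned


section gensmooth
variable {L : FirstOrder.Language} [L.Structure ℝ] [DMin L]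

theorem gen_cont {k : ℕ} {f : (Fin k → ℝ) → ℝ} (hf : DF L f) : Dense {y | ContinuousAt f y} := by
  rw [dense_iff_inter_open]
  intro V hV hne
  by_contra hc
  rw [Set.not_nonempty_iff_eq_empty] at hc
  let S : ℚ × ℚ → (Fin k → ℝ) → Prop := fun q y => ((q.1 : ℝ) < f y ∧ f y < q.2) ∧
    ¬ ∀ᶠ y' in 𝓝 y, ((q.1 : ℝ) < f y' ∧ f y' < q.2)
  have hS : ∀ q, DP L (S q) := by
    intro q
    refine DP.and (DP.and (DP.lt (DF.const _) hf) (DP.lt hf (DF.const _))) (DP.not ?_)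
    refine DP.nhds (Q := fun _ y' => (q.1 : ℝ) < f y' ∧ f y' < q.2) (fun j => DF.var _) ?_
    have : DF L fun w : Fin k ⊕ Fin k → ℝ => f fun j => w (Sum.inr j) := hf.comp fun _ => DF.var _
    exact DP.and (DP.lt (DF.const _) this) (DP.lt this (DF.const _))
  obtain ⟨q, y, hy, hyV⟩ := baireD (L := L) hV hne S hS (by
    intro y hy
    have hnc : ¬ ContinuousAt f y := fun h => by
      have : y ∈ V ∩ {y | ContinuousAt f y} := ⟨hy, h⟩
      rw [hc] at this; exact this
    by_contra hcc
    simp only [mem_iUnion, S, mem_setOf_eq, not_exists, not_and, not_not] at hcc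
    refine hnc ?_
    rw [ContinuousAt, Metric.tendsto_nhds]
    intro ε hε
    obtain ⟨q1, h1, h1'⟩ := exists_rat_btwn (show f y - ε < f y by linarith)
    obtain ⟨q2, h2, h2'⟩ := exists_rat_btwn (show f y < f y + ε by linarith)
    filter_upwards [hcc (q1, q2) ⟨h1', h2⟩] with y' hy'
    rw [Real.dist_eq, abs_lt]
    constructor <;> linarith [hy'.1, hy'.2])
  have h2 : ∀ᶠ y' in 𝓝 y, S q y' := by
    have := isOpen_interior.mem_nhds hy
    filter_upwards [this] with y' hy'
    have h3 : y' ∈ {y | S q y} := interior_subset hy'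
    exact h3
  exact h2.self_of_nhds.2 (h2.mono fun y' h => h.1)

theorem DP.continuousAt {α : Type} [Finite α] {k : ℕ} {F : (α → ℝ) → (Fin k → ℝ) → ℝ}
    (hF : DF L fun w : α ⊕ Fin k → ℝ => F (fun i => w (Sum.inl i)) (fun j => w (Sum.inr j))) :
    DP L fun w : α ⊕ Fin k → ℝ => ContinuousAt (F (fun i => w (Sum.inl i))) (fun j => w (Sum.inr j)) := by
  have hF' : ∀ {δ : Type} [Finite δ] (f : (δ → ℝ) → α → ℝ) (g : (δ → ℝ) → Fin k → ℝ),
      (∀ j, DF L fun v => f v j) → (∀ j, DF L fun v => g v j) → DF L fun v => F (f v) (g v) := by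
    intro δ _ f g hf hg
    exact DF.comp hF (f := fun v => Sum.elim (f v) (g v)) (by
      rintro (j | j)
      · exact hf j
      · exact hg j)
  refine DP.congr (P := fun w => ∀ ε : ℝ, 0 < ε → ∀ᶠ y' in 𝓝 (fun j => w (Sum.inr j)),
    |F (fun i => w (Sum.inl i)) y' - F (fun i => w (Sum.inl i)) (fun j => w (Sum.inr j))| < ε) ?_ ?_
  · refine DP.all (DP.imp (DP.lt (DF.const _) (DF.var _)) ?_)
    refine DP.nhds (Q := fun (w : (α ⊕ Fin k) ⊕ Unit → ℝ) y' => |F (fun i => w (Sum.inl (Sum.inl i))) y' - F (fun i => w (Sum.inl (Sum.inl i))) (fun j => w (Sum.inl (Sum.inr j)))| < w (Sum.inr ()))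
      (fun _ => DF.var _) ?_
    refine DP.lt (DF.abs (DF.sub (hF' _ _ ?_ ?_) (hF' _ _ ?_ ?_))) (DF.var _) <;> exact fun _ => DF.var _
  · intro w
    rw [ContinuousAt, Metric.tendsto_nhds]
    rfl

/-- partial derivative -/
def pd {k : ℕ} (i : Fin k) (f : (Fin k → ℝ) → ℝ) (y : Fin k → ℝ) : ℝ := fderiv ℝ f y (Pi.single i 1)

def lin {k : ℕ} (a : Fin k → ℝ) : (Fin k → ℝ) →L[ℝ] ℝ := ∑ i, a i • ContinuousLinearMap.proj i

theorem lin_apply {k : ℕ} (a x : Fin k → ℝ) : lin a x = ∑ i, a i * x i := by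
  simp [lin]

theorem eq_lin {k : ℕ} (T : (Fin k → ℝ) →L[ℝ] ℝ) : T = lin fun i => T (Pi.single i 1) := by
  ext x
  rw [lin_apply]
  conv_lhs => rw [pi_eq_sum_univ' x, map_sum]
  refine Finset.sum_congr rfl fun i _ => ?_
  rw [map_smul, smul_eq_mul, mul_comm]

/-- concrete derivative predicate -/
def HD {k : ℕ} (f : (Fin k → ℝ) → ℝ) (y a : Fin k → ℝ) : Prop :=
  ∀ η : ℝ, 0 < η → ∀ᶠ y' in 𝓝 y, ∀ s : ℝ, ‖y' - y‖ ≤ s →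
    |f y' - f y - ∑ i, a i * (y' i - y i)| ≤ η * s

theorem HD_iff {k : ℕ} (f : (Fin k → ℝ) → ℝ) (y a : Fin k → ℝ) :
    HD f y a ↔ HasFDerivAt f (lin a) y := by
  rw [hasFDerivAt_iff_isLittleO, Asymptotics.isLittleO_iff]
  constructor
  · intro h c hc
    filter_upwards [h c hc] with y' hy'
    simpa [lin_apply] using hy' _ le_rfl
  · intro h c hc
    filter_upwards [h hc] with y' hy'
    intro s hs
    rw [lin_apply] at hy'
    refine le_trans hy' (by gcongr)

theorem diff_iff_HD {k : ℕ} (f : (Fin k → ℝ) → ℝ) (y : Fin k → ℝ) :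
    DifferentiableAt ℝ f y ↔ ∃ a, HD f y a := by
  constructor
  · rintro ⟨T, hT⟩
    exact ⟨_, (HD_iff _ _ _).2 (eq_lin T ▸ hT)⟩
  · rintro ⟨a, ha⟩
    exact ((HD_iff _ _ _).1 ha).differentiableAt

theorem HD_pd {k : ℕ} {f : (Fin k → ℝ) → ℝ} {y a : Fin k → ℝ} (h : HD f y a) (i : Fin k) : pd i f y = a i := by
  rw [pd, ((HD_iff _ _ _).1 h).fderiv, lin_apply]
  simp [Pi.single_apply]

section fam
variable {α : Type} [Finite α] {k : ℕ} {F : (α → ℝ) → (Fin k → ℝ) → ℝ}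
    (hF : DF L fun w : α ⊕ Fin k → ℝ => F (fun i => w (Sum.inl i)) (fun j => w (Sum.inr j)))

theorem DF.sub2 {F : (α → ℝ) → (Fin k → ℝ) → ℝ}
    (hF : DF L fun w : α ⊕ Fin k → ℝ => F (fun i => w (Sum.inl i)) (fun j => w (Sum.inr j))) {δ : Type} [Finite δ] (f : (δ → ℝ) → α → ℝ) (g : (δ → ℝ) → Fin k → ℝ)
    (hf : ∀ j, DF L fun v => f v j) (hg : ∀ j, DF L fun v => g v j) : DF L fun v => F (f v) (g v) :=
  DF.comp hF (f := fun v => Sum.elim (f v) (g v)) (by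
      rintro (j | j)
      · exact hf j
      · exact hg j)

theorem DP.sub2 {F : (α → ℝ) → (Fin k → ℝ) → Prop}
    (hF : DP L fun w : α ⊕ Fin k → ℝ => F (fun i => w (Sum.inl i)) (fun j => w (Sum.inr j))) {δ : Type} [Finite δ] (f : (δ → ℝ) → α → ℝ) (g : (δ → ℝ) → Fin k → ℝ)
    (hf : ∀ j, DF L fun v => f v j) (hg : ∀ j, DF L fun v => g v j) : DP L fun v => F (f v) (g v) :=
  DP.comp hF (f := fun v => Sum.elim (f v) (g v)) (by
      rintro (j | j)
      · exact hf j
      · exact hg j)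

end fam

theorem DP.HD {α : Type} [Finite α] {k : ℕ} {F : (α → ℝ) → (Fin k → ℝ) → ℝ}
    (hF : DF L fun w : α ⊕ Fin k → ℝ => F (fun i => w (Sum.inl i)) (fun j => w (Sum.inr j)))
    {δ : Type} [Finite δ] (f : (δ → ℝ) → α → ℝ) (g a : (δ → ℝ) → Fin k → ℝ)
    (hf : ∀ j, DF L fun v => f v j) (hg : ∀ j, DF L fun v => g v j) (ha : ∀ j, DF L fun v => a v j) :
    DP L fun v => HD (F (f v)) (g v) (a v) := by
  unfold DMinPaper.HD
  refine DP.all (DP.imp (DP.lt (DF.const _) (DF.var _)) ?_)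
  refine DP.nhds (Q := fun (w : δ ⊕ Unit → ℝ) y' => ∀ s : ℝ, ‖y' - g (fun i => w (Sum.inl i))‖ ≤ s →
    |F (f (fun i => w (Sum.inl i))) y' - F (f (fun i => w (Sum.inl i))) (g (fun i => w (Sum.inl i))) - ∑ i, a (fun i => w (Sum.inl i)) i * (y' i - g (fun i => w (Sum.inl i)) i)| ≤ w (Sum.inr ()) * s)
    (fun j => (hg j).comp fun _ => DF.var _) ?_
  refine DP.all (DP.imp (DP.norm_le (fun j => DF.var _) (fun j => (hg j).comp fun _ => DF.var _) (DF.var _)) ?_)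
  refine DP.le (DF.abs (DF.sub (DF.sub (DF.sub2 hF _ _ (fun j => (hf j).comp fun _ => DF.var _) fun _ => DF.var _)
    (DF.sub2 hF _ _ (fun j => (hf j).comp fun _ => DF.var _) (fun j => (hg j).comp fun _ => DF.var _)))
    (DF.sum _ fun i => DF.mul ((ha i).comp fun _ => DF.var _) (DF.sub (DF.var _) ((hg i).comp fun _ => DF.var _)))))
    (DF.mul (DF.var _) (DF.var _))

theorem DP.diff {α : Type} [Finite α] {k : ℕ} {F : (α → ℝ) → (Fin k → ℝ) → ℝ}
    (hF : DF L fun w : α ⊕ Fin k → ℝ => F (fun i => w (Sum.inl i)) (fun j => w (Sum.inr j))) :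
    DP L fun w : α ⊕ Fin k → ℝ => DifferentiableAt ℝ (F (fun i => w (Sum.inl i))) (fun j => w (Sum.inr j)) := by
  refine DP.congr (P := fun w => ∃ a, DMinPaper.HD (F (fun i => w (Sum.inl i))) (fun j => w (Sum.inr j)) a) ?_
    fun w => (diff_iff_HD _ _).symm
  exact DP.exV (DP.HD hF _ _ _ (fun _ => DF.var _) (fun _ => DF.var _) (fun _ => DF.var _))

theorem DF.pd {α : Type} [Finite α] {k : ℕ} {F : (α → ℝ) → (Fin k → ℝ) → ℝ}
    (hF : DF L fun w : α ⊕ Fin k → ℝ => F (fun i => w (Sum.inl i)) (fun j => w (Sum.inr j))) (i : Fin k) :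
    DF L fun w : α ⊕ Fin k → ℝ => pd i (F (fun i => w (Sum.inl i))) (fun j => w (Sum.inr j)) := by
  refine DF.of (DP.congr (P := fun w : (α ⊕ Fin k) ⊕ Unit → ℝ =>
    (∃ a, DMinPaper.HD (F (fun i => w (Sum.inl (Sum.inl i)))) (fun j => w (Sum.inl (Sum.inr j))) a ∧ w (Sum.inr ()) = a i) ∨
    ((¬ ∃ a, DMinPaper.HD (F (fun i => w (Sum.inl (Sum.inl i)))) (fun j => w (Sum.inl (Sum.inr j))) a) ∧ w (Sum.inr ()) = 0)) ?_ ?_)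
  · exact DP.or (DP.exV (DP.and (DP.HD hF _ _ _ (fun _ => DF.var _) (fun _ => DF.var _) (fun _ => DF.var _)) (DP.eq (DF.var _) (DF.var _))))
      (DP.and (DP.not (DP.exV (DP.HD hF _ _ _ (fun _ => DF.var _) (fun _ => DF.var _) (fun _ => DF.var _)))) (DP.eq (DF.var _) (DF.const _)))
  · intro w
    by_cases h : ∃ a, DMinPaper.HD (F (fun i => w (Sum.inl (Sum.inl i)))) (fun j => w (Sum.inl (Sum.inr j))) a
    · simp only [h, not_true_eq_false, false_and, or_false]
      constructor
      · rintro ⟨a, ha, e⟩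
        rw [HD_pd ha, e]
      · obtain ⟨a, ha⟩ := h
        intro e
        exact ⟨a, ha, by rw [e, HD_pd ha]⟩
    · have h2 := h
      rw [← diff_iff_HD] at h2
      have h3 : ¬ ∃ a, DMinPaper.HD (F (fun i => w (Sum.inl (Sum.inl i)))) (fun j => w (Sum.inl (Sum.inr j))) a ∧ w (Sum.inr ()) = a i :=
        fun ⟨a, ha, _⟩ => h ⟨a, ha⟩
      simp only [h, h3, not_false_eq_true, true_and, false_or, DMinPaper.pd]
      rw [fderiv_zero_of_not_differentiableAt h2]
      rfl

/-- recursive smoothness predicate -/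
def CD {k : ℕ} : ℕ → ((Fin k → ℝ) → ℝ) → (Fin k → ℝ) → Prop
  | 0, f, y => ∀ᶠ y' in 𝓝 y, ContinuousAt f y'
  | p + 1, f, y => (∀ᶠ y' in 𝓝 y, DifferentiableAt ℝ f y') ∧ ∀ i, CD p (pd i f) y

theorem CD.contDiffAt {k : ℕ} (p : ℕ) : ∀ {f : (Fin k → ℝ) → ℝ} {y : Fin k → ℝ}, CD p f y →
    ContDiffAt ℝ p f y := by
  induction p with
  | zero =>
    intro f y h
    rw [Nat.cast_zero, contDiffAt_zero]
    exact ⟨_, h, fun y' hy' => hy'.continuousWithinAt⟩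
  | succ p ih =>
    intro f y h
    rw [Nat.cast_succ, contDiffAt_succ_iff_hasFDerivAt]
    refine ⟨fderiv ℝ f, ⟨_, h.1, fun x hx => hx.hasFDerivAt⟩, ?_⟩
    have : fderiv ℝ f = fun y => ∑ i, pd i f y • (ContinuousLinearMap.proj i : (Fin k → ℝ) →L[ℝ] ℝ) := by
      ext1 y; exact eq_lin _
    rw [this]
    exact ContDiffAt.sum fun i _ => (ih (h.2 i)).smul contDiffAt_const

theorem CD_open {k : ℕ} (p : ℕ) : ∀ (f : (Fin k → ℝ) → ℝ), IsOpen {y | CD p f y} := by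
  induction p with
  | zero => intro f; exact isOpen_setOf_eventually_nhds
  | succ p ih =>
    intro f
    have : {y | CD (p+1) f y} = {y | ∀ᶠ y' in 𝓝 y, DifferentiableAt ℝ f y'} ∩ ⋂ i, {y | CD p (pd i f) y} := by
      ext y; simp [CD]
    rw [this]
    exact isOpen_setOf_eventually_nhds.inter (isOpen_iInter_of_finite fun i => ih _)

theorem DP.CD {α : Type} [Finite α] {k : ℕ} (p : ℕ) : ∀ {F : (α → ℝ) → (Fin k → ℝ) → ℝ}
    (hF : DF L fun w : α ⊕ Fin k → ℝ => F (fun i => w (Sum.inl i)) (fun j => w (Sum.inr j))),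
    DP L fun w : α ⊕ Fin k → ℝ => CD p (F (fun i => w (Sum.inl i))) (fun j => w (Sum.inr j)) := by
  induction p with
  | zero =>
    intro F hF
    exact DP.nhds (Q := fun (w : α ⊕ Fin k → ℝ) y => ContinuousAt (F (fun i => w (Sum.inl i))) y)
      (fun _ => DF.var _) (DP.sub2 (F := fun c y => ContinuousAt (F c) y) (DP.continuousAt hF) _ _ (fun _ => DF.var _) (fun _ => DF.var _))
  | succ p ih =>
    intro F hF
    refine DP.and (DP.nhds (Q := fun (w : α ⊕ Fin k → ℝ) y => DifferentiableAt ℝ (F (fun i => w (Sum.inl i))) y)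
      (fun _ => DF.var _) (DP.sub2 (F := fun c y => DifferentiableAt ℝ (F c) y) (DP.diff hF) _ _ (fun _ => DF.var _) (fun _ => DF.var _)))
      (DP.allF fun i => ih (F := fun c => DMinPaper.pd i (F c)) (DF.pd hF i))

theorem gen_diff {k : ℕ} {f : (Fin k → ℝ) → ℝ} (hf : DF L f) : Dense {y | DifferentiableAt ℝ f y} := by
  have hcd : DP L fun y => ContinuousAt f y := by
    have := DP.continuousAt (α := Empty) (F := fun _ => f) (hf.comp fun _ => DF.var _)
    exact DP.sub2 (F := fun _ y => ContinuousAt f y) this (fun _ => Empty.elim) (fun v => v) (fun j => j.elim) (fun _ => DF.var _)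
  have hd := dense_interior hcd (gen_cont hf)
  rw [dense_iff_inter_open]
  intro V hV hne
  obtain ⟨x0, hx0V, hx0⟩ := dense_iff_inter_open.1 hd V hV hne
  set U := interior {y | ContinuousAt f y} ∩ V with hU
  have hUo : IsOpen U := isOpen_interior.inter hV
  let S : ℕ → (Fin k → ℝ) → Prop := fun m y => ∀ y', ‖y' - y‖ < 1 / ((m : ℝ) + 1) →
    ∀ s, ‖y' - y‖ ≤ s → f y - ((m : ℝ) + 1) * s ≤ f y'
  have hS : ∀ m, DP L (S m) := by
    intro m
    refine DP.allV (DP.imp (DP.norm_lt (fun _ => DF.var _) (fun _ => DF.var _) (DF.const _))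
      (DP.all (DP.imp (DP.norm_le (fun _ => DF.var _) (fun _ => DF.var _) (DF.var _))
      (DP.le (DF.sub (hf.comp fun _ => DF.var _) (DF.mul (DF.const _) (DF.var _))) (hf.comp fun _ => DF.var _)))))
  have hSd : ∀ U' ⊆ U, IsOpen U' → U'.Nonempty → ∃ y ∈ U', ∃ m, S m y := by
    intro U' hU' hU'o ⟨y0, hy0⟩
    obtain ⟨r, hr, hrU⟩ := Metric.nhds_basis_closedBall.mem_iff.1 (hU'o.mem_nhds hy0)
    have hcont : ContinuousOn f (Metric.closedBall y0 r) := fun y hy => by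
      have h3 : y ∈ {y | ContinuousAt f y} := interior_subset (hU' (hrU hy)).1
      exact ContinuousAt.continuousWithinAt h3
    have hcomp : IsCompact (Metric.closedBall y0 r) := isCompact_closedBall _ _
    obtain ⟨ym, hym, hmin⟩ := hcomp.exists_isMinOn ⟨y0, Metric.mem_closedBall_self hr.le⟩ hcont
    obtain ⟨M, hM⟩ := exists_nat_gt ((f y0 - f ym) / r)
    rw [div_lt_iff₀ hr] at hM
    have hc2 : ContinuousOn (fun y => f y + M * dist y y0) (Metric.closedBall y0 r) :=
      hcont.add (by fun_prop)
    obtain ⟨ys, hys, hmin2⟩ := hcomp.exists_isMinOn ⟨y0, Metric.mem_closedBall_self hr.le⟩ hc2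
    have hys2 : dist ys y0 < r := by
      have h1 : f ys + M * dist ys y0 ≤ f y0 + M * dist y0 y0 := hmin2 (Metric.mem_closedBall_self hr.le)
      rw [dist_self] at h1
      have h2 : f ym ≤ f ys := hmin hys
      by_contra hcc
      push Not at hcc
      have : (M : ℝ) * r ≤ M * dist ys y0 := by gcongr
      linarith
    obtain ⟨m1, hm1⟩ := exists_nat_one_div_lt (sub_pos.2 hys2)
    refine ⟨ys, hrU hys, M + m1, fun y' hy' s hs => ?_⟩
    have hd1 : dist y' ys < 1 / ((m1 : ℝ) + 1) := by
      rw [dist_eq_norm]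
      refine hy'.trans_le ?_
      apply one_div_le_one_div_of_le (by positivity)
      push_cast
      have : (0:ℝ) ≤ M := by positivity
      linarith
    have hy'b : y' ∈ Metric.closedBall y0 r := by
      rw [Metric.mem_closedBall]
      linarith [dist_triangle y' ys y0]
    have h1 : f ys + M * dist ys y0 ≤ f y' + M * dist y' y0 := hmin2 hy'b
    have h2 : (M : ℝ) * dist y' y0 ≤ M * (s + dist ys y0) := by
      gcongr
      have := dist_triangle y' ys y0
      rw [dist_eq_norm y' ys] at this
      linarith
    have hs0 : 0 ≤ s := (norm_nonneg _).trans hs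
    push_cast
    have h3 : 0 ≤ ((m1 : ℝ) + 1) * s := by positivity
    nlinarith
  have hcov : ∃ m, (interior {y | S m y} ∩ U).Nonempty := by
    obtain ⟨y1, h1, h2⟩ := idense (L := L) k (A := fun y => ∃ m, S m y) (B := U) (by
      refine DP.congr (P := fun y => ∃ m : ℝ, 1 ≤ m ∧ ∀ y', ‖y' - y‖ < 1 / m →
        ∀ s, ‖y' - y‖ ≤ s → f y - m * s ≤ f y') ?_ ?_
      · refine DP.ex (DP.and (DP.le (DF.const _) (DF.var _)) (DP.allV (DP.imp (DP.norm_lt (fun _ => DF.var _) (fun _ => DF.var _) (DF.div (DF.const _) (DF.var _)))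
          (DP.all (DP.imp (DP.norm_le (fun _ => DF.var _) (fun _ => DF.var _) (DF.var _))
          (DP.le (DF.sub (hf.comp fun _ => DF.var _) (DF.mul (DF.var _) (DF.var _))) (hf.comp fun _ => DF.var _)))))))
      · intro y
        constructor
        · rintro ⟨m, hm1, hm⟩
          obtain ⟨M, hM⟩ := exists_nat_gt m
          refine ⟨M, fun y' hy' s hs => ?_⟩
          have h1 := hm y' (hy'.trans_le (one_div_le_one_div_of_le (by linarith) (by linarith))) s hs
          have hs0 : 0 ≤ s := (norm_nonneg _).trans hs
          nlinarith
        · rintro ⟨m, hm⟩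
          exact ⟨(m : ℝ) + 1, by have : (0:ℝ) ≤ m := by positivity
                                 linarith, hm⟩) hUo ⟨x0, hx0, hx0V⟩ (by
      intro y hy
      rw [mem_closure_iff]
      intro O hO hyO
      obtain ⟨z, hz, hm⟩ := hSd (O ∩ U) inter_subset_right (hO.inter hUo) ⟨y, hyO, hy⟩
      exact ⟨z, hz.1, hm⟩)
    obtain ⟨m, y, h3, h4⟩ := baireD (L := L) (isOpen_interior.inter hUo) ⟨y1, h1, h2⟩ S hS (by
      intro y hy
      have h5 : y ∈ {y | ∃ m, S m y} := interior_subset hy.1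
      exact mem_iUnion.2 h5)
    exact ⟨m, y, h3, h4.2⟩
  obtain ⟨m, y, hy1, hy2⟩ := hcov
  obtain ⟨r, hr, hrs⟩ := Metric.isOpen_iff.1 (isOpen_interior.inter hUo) y ⟨hy1, hy2⟩
  set r' := min r (1 / (2 * ((m : ℝ) + 1))) with hr'
  have hr'0 : 0 < r' := lt_min hr (by positivity)
  have hlip : LipschitzOnWith ((m : NNReal) + 1) f (Metric.ball y r') := by
    have key : ∀ a ∈ Metric.ball y r', ∀ b ∈ Metric.ball y r', f a - f b ≤ ((m : ℝ) + 1) * dist a b := by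
      intro a ha b hb
      have hSa : a ∈ {y | S m y} := interior_subset (hrs (Metric.ball_subset_ball (min_le_left _ _) ha)).1
      have h1 : ‖b - a‖ < 1 / ((m : ℝ) + 1) := by
        rw [← dist_eq_norm]
        have h2 := dist_triangle_right b a y
        have h3 := (Metric.mem_ball.1 ha).trans_le (min_le_right _ _)
        have h4 := (Metric.mem_ball.1 hb).trans_le (min_le_right _ _)
        have h5 : 1 / ((m : ℝ) + 1) = 1 / (2 * ((m : ℝ) + 1)) + 1 / (2 * ((m : ℝ) + 1)) := by
          field_simp; norm_num
        linarith
      have := hSa b h1 _ le_rfl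
      rw [← dist_eq_norm, dist_comm] at this
      linarith
    refine LipschitzOnWith.of_dist_le_mul fun a ha b hb => ?_
    rw [Real.dist_eq, abs_le]
    push_cast
    constructor
    · have := key b hb a ha
      rw [dist_comm] at this
      linarith
    · exact key a ha b hb
  have hae := hlip.ae_differentiableWithinAt_of_mem (μ := MeasureTheory.volume)
  have hpos : MeasureTheory.volume (Metric.ball y r') ≠ 0 :=
    (Metric.measure_ball_pos _ _ hr'0).ne'
  by_contra hcon
  refine hpos (MeasureTheory.measure_mono_null ?_ (MeasureTheory.ae_iff.1 hae))
  intro z hz hz2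
  refine hcon ⟨z, ((hrs (Metric.ball_subset_ball (min_le_left _ _) hz)).2).2, ?_⟩
  exact (hz2 hz).differentiableAt (Metric.isOpen_ball.mem_nhds hz)

theorem CD_dense {k : ℕ} (p : ℕ) : ∀ {f : (Fin k → ℝ) → ℝ} (hf : DF L f), Dense {y | CD p f y} := by
  have aux : ∀ {P : (Fin k → ℝ) → Prop}, DP L P → Dense {y | P y} → Dense {y | ∀ᶠ y' in 𝓝 y, P y'} := by
    intro P hP hd
    have := dense_interior hP hd
    refine this.mono fun y hy => ?_
    exact mem_interior_iff_mem_nhds.1 hy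
  have tr : ∀ {Q : ((Fin k → ℝ) → ℝ) → (Fin k → ℝ) → Prop} {f}, (DP L fun w : Empty ⊕ Fin k → ℝ => Q f (fun j => w (Sum.inr j))) → DP L fun y => Q f y := by
    intro Q f h
    exact DP.sub2 (F := fun _ y => Q f y) h (fun _ => Empty.elim) (fun v => v) (fun j => j.elim) (fun _ => DF.var _)
  induction p with
  | zero =>
    intro f hf
    exact aux (tr (Q := ContinuousAt) (DP.continuousAt (α := Empty) (F := fun _ => f) (hf.comp fun _ => DF.var _))) (gen_cont hf)
  | succ p ih =>
    intro f hf
    have hpd : ∀ i, DF L (pd i f) := fun i =>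
      DF.sub2 (F := fun _ y => pd i f y) (DF.pd (α := Empty) (F := fun _ => f) (hf.comp fun _ => DF.var _) i) (fun _ => Empty.elim) (fun v => v) (fun j => j.elim) (fun _ => DF.var _)
    have : {y | CD (p+1) f y} = {y | ∀ᶠ y' in 𝓝 y, DifferentiableAt ℝ f y'} ∩ ⋂ i, {y | CD p (pd i f) y} := by
      ext y; simp [CD]
    rw [this]
    refine (aux (tr (Q := DifferentiableAt ℝ) (DP.diff (α := Empty) (F := fun _ => f) (hf.comp fun _ => DF.var _))) (gen_diff hf)).inter_of_isOpen_left ?_ isOpen_setOf_eventually_nhds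
    exact dense_iInter_of_isOpen (fun i => CD_open _ _) fun i => ih (hpd i)

end gensmooth


section regular
variable {L : FirstOrder.Language} [L.Structure ℝ] [DMin L]

/-- points isolated in their fibre -/
def ZZ {n k : ℕ} (X : Set (Fin n → ℝ)) (ι : Fin k → Fin n) : Set (Fin n → ℝ) :=
  {x | x ∈ X ∧ ∃ r : ℝ, 0 < r ∧ ∀ x', x' ∈ X → projc ι x' = projc ι x → ‖x' - x‖ < r → x' = x}

theorem DP.eqV {α : Type} [Finite α] {k : ℕ} {f g : (α → ℝ) → Fin k → ℝ}
    (hf : ∀ j, DF L fun v => f v j) (hg : ∀ j, DF L fun v => g v j) : DP L fun v => f v = g v :=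
  (DP.allF fun j => DP.eq (hf j) (hg j)).congr fun v => funext_iff.symm

theorem ZZ_def {n k : ℕ} {X : Set (Fin n → ℝ)} (hX : IsDef L X) (ι : Fin k → Fin n) : IsDef L (ZZ X ι) := by
  refine DP.and (DP.mem hX fun _ => DF.var _) (DP.ex (DP.and (DP.lt (DF.const _) (DF.var _)) (DP.allV
    (DP.imp (DP.mem hX fun _ => DF.var _) (DP.imp (DP.eqV (fun _ => DF.var _) (fun _ => DF.var _)) (DP.imp (DP.norm_lt (fun _ => DF.var _) (fun _ => DF.var _) (DF.var _))
    (DP.eqV (fun _ => DF.var _) (fun _ => DF.var _))))))))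

/-- section predicate -/
def Sec {n k : ℕ} (X : Set (Fin n → ℝ)) (ι : Fin k → Fin n) (a : Fin n ⊕ Unit → ℝ) (y : Fin k → ℝ)
    (x : Fin n → ℝ) : Prop :=
  x ∈ X ∧ ‖x - fun i => a (Sum.inl i)‖ < a (Sum.inr ()) ∧ projc ι x = y

def USec {n k : ℕ} (X : Set (Fin n → ℝ)) (ι : Fin k → Fin n) (a : Fin n ⊕ Unit → ℝ) (y : Fin k → ℝ) : Prop :=
  ∃ x, Sec X ι a y x ∧ ∀ x', Sec X ι a y x' → x' = x

def fsec {n k : ℕ} (X : Set (Fin n → ℝ)) (ι : Fin k → Fin n) (a : Fin n ⊕ Unit → ℝ) (y : Fin k → ℝ) : Fin n → ℝ :=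
  if h : USec X ι a y then h.choose else 0

theorem fsec_spec {n k : ℕ} {X : Set (Fin n → ℝ)} {ι : Fin k → Fin n} {a : Fin n ⊕ Unit → ℝ} {y : Fin k → ℝ}
    (h : USec X ι a y) : Sec X ι a y (fsec X ι a y) ∧ ∀ x', Sec X ι a y x' → x' = fsec X ι a y := by
  rw [fsec, dif_pos h]; exact h.choose_spec

section
variable {n k : ℕ} {X : Set (Fin n → ℝ)} (hX : IsDef L X) (ι : Fin k → Fin n) {δ : Type} [Finite δ]
  {a : (δ → ℝ) → Fin n ⊕ Unit → ℝ} {y : (δ → ℝ) → Fin k → ℝ} {x : (δ → ℝ) → Fin n → ℝ}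
  (ha : ∀ j, DF L fun v => a v j) (hy : ∀ j, DF L fun v => y v j) (hx : ∀ j, DF L fun v => x v j)

theorem Sec_def (hX : IsDef L X)
  (ha : ∀ j, DF L fun v => a v j) (hy : ∀ j, DF L fun v => y v j) (hx : ∀ j, DF L fun v => x v j) : DP L fun v => Sec X ι (a v) (y v) (x v) :=
  DP.and (DP.mem hX hx) (DP.and (DP.norm_lt hx (fun j => ha _) (ha _)) (DP.eqV (fun j => hx _) hy))

theorem USec_def (hX : IsDef L X)
  (ha : ∀ j, DF L fun v => a v j) (hy : ∀ j, DF L fun v => y v j) : DP L fun v => USec X ι (a v) (y v) := by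
  refine DP.exV (DP.and (Sec_def ι hX (fun j => (ha j).comp fun _ => DF.var _) (fun j => (hy j).comp fun _ => DF.var _) fun _ => DF.var _)
    (DP.allV (DP.imp (Sec_def ι hX (fun j => (ha j).comp fun _ => DF.var _) (fun j => (hy j).comp fun _ => DF.var _) fun _ => DF.var _)
    (DP.eqV (fun _ => DF.var _) (fun _ => DF.var _)))))

theorem fsec_def (hX : IsDef L X)
  (ha : ∀ j, DF L fun v => a v j) (hy : ∀ j, DF L fun v => y v j) (j : Fin n) : DF L fun v => fsec X ι (a v) (y v) j := by
  have ha' : ∀ j, DF L fun v : δ ⊕ Unit → ℝ => a (fun i => v (Sum.inl i)) j := fun j => (ha j).comp fun _ => DF.var _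
  have hy' : ∀ j, DF L fun v : δ ⊕ Unit → ℝ => y (fun i => v (Sum.inl i)) j := fun j => (hy j).comp fun _ => DF.var _
  refine DF.of (DP.congr (P := fun w : δ ⊕ Unit → ℝ =>
    (USec X ι (a fun i => w (Sum.inl i)) (y fun i => w (Sum.inl i)) ∧ ∃ x, Sec X ι (a fun i => w (Sum.inl i)) (y fun i => w (Sum.inl i)) x ∧ w (Sum.inr ()) = x j) ∨
    (¬ USec X ι (a fun i => w (Sum.inl i)) (y fun i => w (Sum.inl i)) ∧ w (Sum.inr ()) = 0)) ?_ ?_)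
  · refine DP.or (DP.and (USec_def ι hX ha' hy') (DP.exV (DP.and (Sec_def ι hX (fun j => (ha' j).comp fun _ => DF.var _) (fun j => (hy' j).comp fun _ => DF.var _) fun _ => DF.var _)
      (DP.eq (DF.var _) (DF.var _))))) (DP.and (USec_def ι hX ha' hy').not (DP.eq (DF.var _) (DF.const _)))
  · intro w
    by_cases h : USec X ι (a fun i => w (Sum.inl i)) (y fun i => w (Sum.inl i))
    · obtain ⟨h1, h2⟩ := fsec_spec h
      simp only [h, true_and, not_true_eq_false, false_and, or_false]
      constructor
      · rintro ⟨x, hx, e⟩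
        rw [e, h2 x hx]
      · intro e
        exact ⟨_, h1, e⟩
    · simp [h, fsec]
end

/-- regular points -/
def Reg {n k : ℕ} (p : ℕ) (X : Set (Fin n → ℝ)) (ι : Fin k → Fin n) (e : (Fin n → ℝ) → ℝ) (x : Fin n → ℝ) : Prop :=
  ∃ a : Fin n ⊕ Unit → ℝ, ‖x - fun i => a (Sum.inl i)‖ < a (Sum.inr ()) ∧
    (∀ᶠ y in 𝓝 (projc ι x), USec X ι a y) ∧ (∀ j, CD p (fun y => fsec X ι a y j) (projc ι x)) ∧
    CD p (fun y => e (fsec X ι a y)) (projc ι x)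

theorem Reg_def {n k : ℕ} (p : ℕ) {X : Set (Fin n → ℝ)} (hX : IsDef L X) (ι : Fin k → Fin n) {e : (Fin n → ℝ) → ℝ}
    (he : DF L e) : DP L fun x => Reg p X ι e x := by
  refine DP.exV (DP.and (DP.norm_lt (fun _ => DF.var _) (fun _ => DF.var _) (DF.var _)) (DP.and ?_ (DP.and (DP.allF fun j => ?_) ?_)))
  · exact DP.nhds (Q := fun (w : Fin n ⊕ (Fin n ⊕ Unit) → ℝ) y => USec X ι (fun j => w (Sum.inr j)) y) (fun _ => DF.var _) (USec_def ι hX (fun _ => DF.var _) (fun _ => DF.var _))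
  · exact DP.sub2 (F := fun a y => CD p (fun y => fsec X ι a y j) y) (DP.CD p (F := fun a y => fsec X ι a y j) (fsec_def ι hX (fun _ => DF.var _) (fun _ => DF.var _) j)) _ _ (fun _ => DF.var _) (fun _ => DF.var _)
  · exact DP.sub2 (F := fun a y => CD p (fun y => e (fsec X ι a y)) y) (DP.CD p (F := fun a y => e (fsec X ι a y)) (he.comp (fsec_def ι hX (fun _ => DF.var _) (fun _ => DF.var _)))) _ _ (fun _ => DF.var _) (fun _ => DF.var _)

theorem regular {n k : ℕ} (p : ℕ) {X : Set (Fin n → ℝ)} (hX : IsDef L X) (ι : Fin k → Fin n) {e : (Fin n → ℝ) → ℝ}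
    (he : DF L e) : ∃ W : Set (Fin k → ℝ), IsClosed W ∧ IsDef L W ∧ interior W = ∅ ∧
      ∀ x ∈ ZZ X ι, projc ι x ∉ W → ∃ (τ : (Fin k → ℝ) → Fin n → ℝ) (δ : ℝ), 0 < δ ∧ τ (projc ι x) = x ∧
        (∀ᶠ y in 𝓝 (projc ι x), τ y ∈ X ∧ projc ι (τ y) = y ∧ ∀ x' ∈ X, projc ι x' = y → ‖x' - x‖ < δ → x' = τ y) ∧
        ContDiffAt ℝ p τ (projc ι x) ∧ ContDiffAt ℝ p (fun y => e (τ y)) (projc ι x) := by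
  let Bad : Set (Fin k → ℝ) := {y | ∃ x, x ∈ ZZ X ι ∧ projc ι x = y ∧ ¬ Reg p X ι e x}
  have hBad : IsDef L Bad := DP.exV (DP.and (DP.mem (ZZ_def hX ι) (fun _ => DF.var _)) (DP.and (DP.eqV (fun _ => DF.var _) (fun _ => DF.var _))
    ((Reg_def p hX ι he).comp fun _ => DF.var _).not))
  have hcl : IsDef L (closure Bad) := DP.closure hBad (f := fun v => v) fun _ => DF.var _
  have hdense : Dense {y | ¬ y ∈ Bad} := by
    rw [dense_iff_inter_open]
    intro V hV hne
    by_contra hcon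
    have hVB : V ⊆ Bad := by
      intro y hy
      by_contra h
      exact hcon ⟨y, hy, h⟩
    let ar : (Fin n → ℚ) × ℚ → Fin n ⊕ Unit → ℝ := fun q => Sum.elim (fun i => (q.1 i : ℝ)) (fun _ => (q.2 : ℝ))
    let S : (Fin n → ℚ) × ℚ → (Fin k → ℝ) → Prop := fun q y => USec X ι (ar q) y ∧ ¬ Reg p X ι e (fsec X ι (ar q) y)
    have hac : ∀ q j, DF L fun _ : Fin k → ℝ => ar q j := fun q j => DF.const _
    have hf : ∀ q j, DF L fun y : Fin k → ℝ => fsec X ι (ar q) y j := fun q j => 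
      fsec_def ι hX (a := fun _ => ar q) (y := fun y => y) (hac q) (fun _ => DF.var _) j
    have hS : ∀ q, DP L (S q) := fun q =>
      DP.and (USec_def ι hX (a := fun _ => ar q) (y := fun y => y) (hac q) (fun _ => DF.var _))
        ((Reg_def p hX ι he).comp (hf q)).not
    obtain ⟨q, hq⟩ := baireD (L := L) hV hne S hS (by
      intro y hy
      obtain ⟨x, ⟨hxX, r, hr, hxr⟩, hxy, hxR⟩ := hVB hy
      obtain ⟨q2, h1, h2⟩ := exists_rat_btwn (show 0 < r / 2 by linarith)
      have hq1 : ∀ i, ∃ t : ℚ, |x i - t| < q2 / 2 := by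
        intro i
        obtain ⟨t, h3, h4⟩ := exists_rat_btwn (show x i - q2 / 2 < x i by linarith)
        exact ⟨t, by rw [abs_lt]; constructor <;> linarith⟩
      choose q1 hq1 using hq1
      have hn : ‖x - fun i => (q1 i : ℝ)‖ < q2 := by
        rw [pi_norm_lt_iff h1]
        intro i
        rw [Real.norm_eq_abs]
        exact (hq1 i).trans (by linarith)
      have hsec : Sec X ι (ar (q1, q2)) y x := ⟨hxX, hn, hxy⟩
      have hu : ∀ x', Sec X ι (ar (q1, q2)) y x' → x' = x := by
        rintro x' ⟨h3, h4, h5⟩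
        refine hxr x' h3 (h5.trans hxy.symm) ?_
        have h6 : ‖x' - fun i => (q1 i : ℝ)‖ < q2 := h4
        have h7 : x' - x = (x' - fun i => (q1 i : ℝ)) - (x - fun i => (q1 i : ℝ)) := by abel
        rw [h7]
        refine (norm_sub_le _ _).trans_lt (by linarith)
      have hU : USec X ι (ar (q1, q2)) y := ⟨x, hsec, hu⟩
      refine mem_iUnion.2 ⟨(q1, q2), hU, ?_⟩
      rw [hu _ (fsec_spec hU).1]
      exact hxR)
    set O := interior {y | S q y} ∩ V
    have hO : IsOpen O := isOpen_interior.inter hV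
    have hd1 : Dense ({y | CD p (fun y => e (fsec X ι (ar q) y)) y} ∩ ⋂ j, {y | CD p (fun y => fsec X ι (ar q) y j) y}) := by
      refine (CD_dense p (he.comp (hf q))).inter_of_isOpen_left ?_ (CD_open _ _)
      exact dense_iInter_of_isOpen (fun i => CD_open _ _) fun i => CD_dense p (hf q i)
    obtain ⟨y, hyO, hy1, hy2⟩ := dense_iff_inter_open.1 hd1 O hO hq
    have hSy : ∀ y ∈ O, S q y := fun y hy => by
      have h3 : y ∈ {y | S q y} := interior_subset hy.1
      exact h3
    have hs := (fsec_spec (hSy y hyO).1).1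
    refine (hSy y hyO).2 ⟨ar q, hs.2.1, ?_, ?_, ?_⟩
    · rw [hs.2.2]
      filter_upwards [hO.mem_nhds hyO] with y' hy'
      exact (hSy y' hy').1
    · rw [hs.2.2]; simpa using hy2
    · rw [hs.2.2]; exact hy1
  refine ⟨closure Bad, isClosed_closure, hcl, ?_, ?_⟩
  · have := dense_interior (L := L) (S := fun y => ¬ y ∈ Bad) (DP.not hBad) hdense
    rw [interior_eq_empty_iff_dense_compl, ← interior_compl]
    exact this
  · intro x hx hxW
    have hR : Reg p X ι e x := by
      by_contra h
      exact hxW (subset_closure ⟨x, hx, rfl, h⟩)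
    obtain ⟨a, h1, h2, h3, h4⟩ := hR
    have h2x := fsec_spec h2.self_of_nhds
    refine ⟨fsec X ι a, a (Sum.inr ()) - ‖x - fun i => a (Sum.inl i)‖, by linarith, (h2x.2 x ⟨hx.1, h1, rfl⟩).symm, ?_, ?_, h4.contDiffAt⟩
    · filter_upwards [h2] with y hy
      obtain ⟨h5, h6⟩ := fsec_spec hy
      refine ⟨h5.1, h5.2.2, fun x' hx' hxy hd => h6 x' ⟨hx', ?_, hxy⟩⟩
      have h7 : (x' - fun i => a (Sum.inl i)) = (x' - x) + (x - fun i => a (Sum.inl i)) := by abel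
      rw [h7]
      refine (norm_add_le _ _).trans_lt (by linarith)
    · rw [contDiffAt_pi]
      exact fun j => (h3 j).contDiffAt

end regular


section thetas
/-- truncated power -/
def tp (p : ℕ) (s : ℝ) : ℝ := (max 0 s) ^ (p + 1)

theorem tp_hasDeriv (p : ℕ) (s : ℝ) : HasDerivAt (tp (p + 1)) ((p + 2 : ℝ) * tp p s) s := by
  rcases lt_trichotomy s 0 with h | h | h
  · have h1 : tp p s = 0 := by simp [tp, max_eq_left h.le]
    rw [h1, mul_zero]
    refine (hasDerivAt_const s (0 : ℝ)).congr_of_eventuallyEq ?_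
    filter_upwards [gt_mem_nhds h] with t ht
    simp [tp, max_eq_left (le_of_lt ht)]
  · subst h
    have h1 : tp p 0 = 0 := by simp [tp]
    rw [h1, mul_zero, hasDerivAt_iff_isLittleO, Asymptotics.isLittleO_iff]
    intro c hc
    filter_upwards [Metric.ball_mem_nhds (0:ℝ) (lt_min hc one_pos)] with t ht
    rw [Metric.mem_ball, dist_zero_right, Real.norm_eq_abs] at ht
    have h2 : tp (p+1) 0 = 0 := by simp [tp]
    simp only [h2, sub_zero, smul_zero, Real.norm_eq_abs]
    have h3 : max 0 t ≤ |t| := max_le (abs_nonneg _) (le_abs_self _)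
    have h0 : 0 ≤ max 0 t := le_max_left _ _
    rw [tp, abs_of_nonneg (by positivity)]
    have h4 : (max 0 t) ^ (p + 1) ≤ |t| := by
      calc (max 0 t) ^ (p + 1) ≤ |t| ^ (p+1) := by gcongr
        _ ≤ |t| ^ 1 := pow_le_pow_of_le_one (abs_nonneg _) (ht.trans_le (min_le_right _ _)).le (by omega)
        _ = |t| := pow_one _
    calc (max 0 t) ^ (p + 1 + 1) = (max 0 t) ^ (p+1) * max 0 t := pow_succ _ _
      _ ≤ c * |t| := by
        apply mul_le_mul (h4.trans (ht.trans_le (min_le_left _ _)).le) h3 h0 hc.le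
  · have h1 : tp p s = s ^ (p+1) := by simp [tp, max_eq_right h.le]
    have := hasDerivAt_pow (p+2) s
    rw [h1]
    refine HasDerivAt.congr_of_eventuallyEq (f := fun x => x ^ (p+2)) ?_ ?_
    · simpa using this
    · filter_upwards [lt_mem_nhds h] with t ht
      simp [tp, max_eq_right (le_of_lt ht)]

theorem tp_contDiff (p : ℕ) : ContDiff ℝ p (tp p) := by
  induction p with
  | zero => 
    rw [Nat.cast_zero, contDiff_zero]
    unfold tp; fun_prop
  | succ p ih =>
    rw [Nat.cast_succ, contDiff_succ_iff_deriv]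
    refine ⟨fun s => (tp_hasDeriv p s).differentiableAt, by simp, ?_⟩
    have : deriv (tp (p+1)) = fun s => (p + 2 : ℝ) * tp p s := funext fun s => (tp_hasDeriv p s).deriv
    rw [this]
    exact contDiff_const.mul ih

theorem tp_nonneg (p : ℕ) (s : ℝ) : 0 ≤ tp p s := pow_nonneg (le_max_left _ _) _
theorem tp_pos (p : ℕ) {s : ℝ} (h : 0 < s) : 0 < tp p s := pow_pos (lt_max_of_lt_right h) _
theorem tp_zero (p : ℕ) {s : ℝ} (h : s ≤ 0) : tp p s = 0 := by simp [tp, max_eq_left h]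

def theta (p : ℕ) (s : ℝ) : ℝ := tp p (1/2 - s) / (tp p (1/2 - s) + tp p (s - 1/4))

theorem theta_den (p : ℕ) (s : ℝ) : 0 < tp p (1/2 - s) + tp p (s - 1/4) := by
  by_cases h : s < 1/2
  · exact add_pos_of_pos_of_nonneg (tp_pos p (by linarith)) (tp_nonneg _ _)
  · exact add_pos_of_nonneg_of_pos (tp_nonneg _ _) (tp_pos p (by linarith))

theorem theta_contDiff (p : ℕ) : ContDiff ℝ p (theta p) := by
  unfold theta
  have h1 : ContDiff ℝ p fun s : ℝ => tp p (1/2 - s) := (tp_contDiff p).comp (by fun_prop)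
  have h2 : ContDiff ℝ p fun s : ℝ => tp p (s - 1/4) := (tp_contDiff p).comp (by fun_prop)
  exact h1.div (h1.add h2) fun s => (theta_den p s).ne'

theorem theta_one (p : ℕ) {s : ℝ} (h : s ≤ 1/4) : theta p s = 1 := by
  have := theta_den p s
  rw [theta, tp_zero p (s := s - 1/4) (by linarith), add_zero] at *
  exact div_self this.ne'
theorem theta_zero (p : ℕ) {s : ℝ} (h : 1/2 ≤ s) : theta p s = 0 := by
  rw [theta, tp_zero p (s := 1/2 - s) (by linarith), zero_div]
theorem theta_nonneg (p : ℕ) (s : ℝ) : 0 ≤ theta p s := div_nonneg (tp_nonneg _ _) (theta_den _ _).le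
theorem theta_le_one (p : ℕ) (s : ℝ) : theta p s ≤ 1 :=
  (div_le_one (theta_den _ _)).2 (by linarith [tp_nonneg p (s - 1/4)])

/-- squared Euclidean distance -/
def qd {n : ℕ} (x z : Fin n → ℝ) : ℝ := ∑ i, (x i - z i) ^ 2

theorem qd_self {n : ℕ} (x : Fin n → ℝ) : qd x x = 0 := by simp [qd]
theorem qd_zero {n : ℕ} {x z : Fin n → ℝ} (h : qd x z ≤ 0) : x = z := by
  have h0 : qd x z = 0 := le_antisymm h (Finset.sum_nonneg fun i _ => sq_nonneg _)
  rw [qd, Finset.sum_eq_zero_iff_of_nonneg fun i _ => sq_nonneg _] at h0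
  ext i
  have := h0 i (Finset.mem_univ _)
  linarith [pow_eq_zero_iff (two_ne_zero) |>.1 this]
theorem qd_norm {n : ℕ} {x z : Fin n → ℝ} {r : ℝ} (hr : 0 < r) (h : qd x z < r ^ 2) : ‖x - z‖ < r := by
  rw [pi_norm_lt_iff hr]
  intro i
  rw [Real.norm_eq_abs]
  refine abs_lt_of_sq_lt_sq ?_ hr.le
  refine lt_of_le_of_lt ?_ h
  exact Finset.single_le_sum (f := fun i => (x i - z i)^2) (fun i _ => sq_nonneg _) (Finset.mem_univ i)
theorem qd_cont {n : ℕ} : Continuous fun v : (Fin n → ℝ) × (Fin n → ℝ) => qd v.1 v.2 := by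
  unfold qd; fun_prop
theorem qd_contDiff {n : ℕ} {m : WithTop ℕ∞} : ContDiff ℝ m fun v : (Fin n → ℝ) × (Fin n → ℝ) => qd v.1 v.2 := by
  unfold qd; fun_prop

/-- unique choice -/
def uch {n : ℕ} (R : (Fin n → ℝ) → Prop) : Fin n → ℝ :=
  if h : ∃ x, R x ∧ ∀ x', R x' → x' = x then h.choose else 0
theorem uch_eq {n : ℕ} {R : (Fin n → ℝ) → Prop} {x : Fin n → ℝ} (h : R x) (h2 : ∀ x', R x' → x' = x) : uch R = x := by
  have h3 : ∃ x, R x ∧ ∀ x', R x' → x' = x := ⟨x, h, h2⟩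
  rw [uch, dif_pos h3]
  exact h2 _ h3.choose_spec.1

variable {L : FirstOrder.Language} [L.Structure ℝ] [DMin L]

theorem DF.uch {δ : Type} [Finite δ] {n : ℕ} {R : (δ → ℝ) → (Fin n → ℝ) → Prop}
    (hR : DP L fun w : δ ⊕ Fin n → ℝ => R (fun i => w (Sum.inl i)) (fun j => w (Sum.inr j))) (j : Fin n) :
    DF L fun v => uch (R v) j := by
  have hU : DP L fun v => ∃ x, R v x ∧ ∀ x', R v x' → x' = x :=
    DP.exV (DP.and hR (DP.allV (DP.imp (DP.sub2 hR _ _ (fun _ => DF.var _) fun _ => DF.var _)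
      (DP.eqV (fun _ => DF.var _) fun _ => DF.var _))))
  refine DF.of (DP.congr (P := fun w : δ ⊕ Unit → ℝ =>
    ((∃ x, R (fun i => w (Sum.inl i)) x ∧ ∀ x', R (fun i => w (Sum.inl i)) x' → x' = x) ∧
      ∃ x, R (fun i => w (Sum.inl i)) x ∧ w (Sum.inr ()) = x j) ∨
    (¬ (∃ x, R (fun i => w (Sum.inl i)) x ∧ ∀ x', R (fun i => w (Sum.inl i)) x' → x' = x) ∧ w (Sum.inr ()) = 0)) ?_ ?_)
  · refine DP.or (DP.and (DP.comp hU fun _ => DF.var _) (DP.exV (DP.and (DP.sub2 hR _ _ (fun _ => DF.var _) fun _ => DF.var _)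
      (DP.eq (DF.var _) (DF.var _))))) (DP.and (DP.comp hU fun _ => DF.var _).not (DP.eq (DF.var _) (DF.const _)))
  · intro w
    by_cases h : ∃ x, R (fun i => w (Sum.inl i)) x ∧ ∀ x', R (fun i => w (Sum.inl i)) x' → x' = x
    · simp only [h, true_and, not_true_eq_false, false_and, or_false]
      obtain ⟨x0, h1, h2⟩ := h
      rw [uch_eq h1 h2]
      constructor
      · rintro ⟨x, hx, e⟩
        rw [e, h2 x hx]
      · intro e
        exact ⟨_, h1, e⟩
    · simp only [h, false_and, not_false_eq_true, true_and, false_or, DMinPaper.uch]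
      simp

theorem DF.tp {δ : Type} [Finite δ] {f : (δ → ℝ) → ℝ} (p : ℕ) (hf : DF L f) : DF L fun v => tp p (f v) :=
  DF.pow (DF.max (DF.const _) hf) _
theorem DF.theta {δ : Type} [Finite δ] {f : (δ → ℝ) → ℝ} (p : ℕ) (hf : DF L f) : DF L fun v => theta p (f v) :=
  DF.div (DF.tp p (DF.sub (DF.const _) hf)) (DF.add (DF.tp p (DF.sub (DF.const _) hf)) (DF.tp p (DF.sub hf (DF.const _))))
theorem DF.qd {δ : Type} [Finite δ] {n : ℕ} {f g : (δ → ℝ) → Fin n → ℝ}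
    (hf : ∀ j, DF L fun v => f v j) (hg : ∀ j, DF L fun v => g v j) : DF L fun v => qd (f v) (g v) :=
  DF.sum _ fun i => DF.pow (DF.sub (hf i) (hg i)) _
end thetas


section glue1
variable {L : FirstOrder.Language} [L.Structure ℝ] [DMin L]

theorem projc_cont {n k : ℕ} (ι : Fin k → Fin n) : Continuous (projc ι) :=
  continuous_pi fun i => continuous_apply _
theorem projc_contDiff {n k : ℕ} (ι : Fin k → Fin n) {m : WithTop ℕ∞} : ContDiff ℝ m (projc ι) :=
  contDiff_pi.2 fun i => contDiff_apply _ _ _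

/-- nice local section -/
structure NS {n k : ℕ} (p : ℕ) (X : Set (Fin n → ℝ)) (ι : Fin k → Fin n) (e : (Fin n → ℝ) → ℝ)
    (x : Fin n → ℝ) (τ : (Fin k → ℝ) → Fin n → ℝ) : Prop where
  val : τ (projc ι x) = x
  cd : ContDiffAt ℝ p τ (projc ι x)
  ce : ContDiffAt ℝ p (fun y => e (τ y)) (projc ι x)
  ev : ∀ᶠ y in 𝓝 (projc ι x), τ y ∈ ZZ X ι ∧ projc ι (τ y) = y ∧ ContinuousAt τ y
  un : ∀ᶠ x' in 𝓝 x, x' ∈ X → x' = τ (projc ι x')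

theorem ns_of {n k : ℕ} {p : ℕ} {X : Set (Fin n → ℝ)} {ι : Fin k → Fin n} {e : (Fin n → ℝ) → ℝ}
    {x : Fin n → ℝ} (h : ∃ (τ : (Fin k → ℝ) → Fin n → ℝ) (δ : ℝ), 0 < δ ∧ τ (projc ι x) = x ∧
        (∀ᶠ y in 𝓝 (projc ι x), τ y ∈ X ∧ projc ι (τ y) = y ∧ ∀ x' ∈ X, projc ι x' = y → ‖x' - x‖ < δ → x' = τ y) ∧
        ContDiffAt ℝ p τ (projc ι x) ∧ ContDiffAt ℝ p (fun y => e (τ y)) (projc ι x)) : ∃ τ, NS p X ι e x τ := by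
  obtain ⟨τ, δ, hδ, h1, h2, h3, h4⟩ := h
  refine ⟨τ, h1, h3, h4, ?_, ?_⟩
  · have hc : ∀ᶠ y in 𝓝 (projc ι x), ‖τ y - x‖ < δ / 2 := by
      have := (h3.continuousAt).tendsto
      rw [h1] at this
      have := this (Metric.ball_mem_nhds x (half_pos hδ))
      filter_upwards [this] with y hy
      simpa [dist_eq_norm] using hy
    filter_upwards [h2, hc, h3.eventually (by simp)] with y hy hyc hyd
    refine ⟨⟨hy.1, δ / 2, half_pos hδ, fun x' hx' hm hd => ?_⟩, hy.2.1, hyd.continuousAt⟩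
    refine hy.2.2 x' hx' (hm.trans hy.2.1) ?_
    have h7 : x' - x = (x' - τ y) + (τ y - x) := by abel
    rw [h7]
    exact (norm_add_le _ _).trans_lt (by linarith)
  · have h5 : ∀ᶠ x' in 𝓝 x, ‖x' - x‖ < δ := by
      filter_upwards [Metric.ball_mem_nhds x hδ] with y hy
      simpa [dist_eq_norm] using hy
    filter_upwards [(projc_cont ι).continuousAt.tendsto.eventually h2, h5] with x' h6 h7 h8
    exact h6.2.2 x' h8 rfl h7

/-- admissible radii -/
def AA {n k : ℕ} (X Y : Set (Fin n → ℝ)) (ψ : (Fin n → ℝ) → ℝ) (ι : Fin k → Fin n) (z : Fin n → ℝ) (c : ℝ) : Prop :=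
  0 < c ∧ c ≤ 1 ∧ (∀ x, x ∈ Y → ‖x - z‖ < c → c ≤ ψ x) ∧
  (∀ z', z' ∈ X → projc ι z' = projc ι z → ‖z' - z‖ < 2 * c → z' = z) ∧
  (∀ x, x ∈ closure (ZZ X ι) → ‖x - z‖ ≤ c → x ∈ ZZ X ι)

def ee {n k : ℕ} (X Y : Set (Fin n → ℝ)) (ψ : (Fin n → ℝ) → ℝ) (ι : Fin k → Fin n) (z : Fin n → ℝ) : ℝ :=
  1/2 * sSup {c | AA X Y ψ ι z c}

theorem AA.mono {n k : ℕ} {X Y : Set (Fin n → ℝ)} {ψ : (Fin n → ℝ) → ℝ} {ι : Fin k → Fin n} {z : Fin n → ℝ} {c c' : ℝ}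
    (h : AA X Y ψ ι z c) (h0 : 0 < c') (hc : c' ≤ c) : AA X Y ψ ι z c' := by
  obtain ⟨h1, h2, h3, h4, h5⟩ := h
  refine ⟨h0, by linarith, fun x hx hd => ?_, fun z' a b d => h4 z' a b (by linarith), fun x hx hd => h5 x hx (by linarith)⟩
  have := h3 x hx (by linarith)
  linarith

theorem ee_def {n k : ℕ} {X Y : Set (Fin n → ℝ)} {ψ : (Fin n → ℝ) → ℝ} (ι : Fin k → Fin n) 
    (hX : IsDef L X) (hY : IsDef L Y) (hψ : DF L ψ) : DF L (ee X Y ψ ι) := by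
  refine DF.mul (DF.const _) (DF.sSup ?_)
  refine DP.and (DP.lt (DF.const _) (DF.var _)) (DP.and (DP.le (DF.var _) (DF.const _)) (DP.and ?_ (DP.and ?_ ?_)))
  · exact DP.allV (DP.imp (DP.mem hY fun _ => DF.var _) (DP.imp (DP.norm_lt (fun _ => DF.var _) (fun _ => DF.var _) (DF.var _))
      (DP.le (DF.var _) (hψ.comp fun _ => DF.var _))))
  · exact DP.allV (DP.imp (DP.mem hX fun _ => DF.var _) (DP.imp (DP.eqV (fun _ => DF.var _) (fun _ => DF.var _)) (DP.imp (DP.norm_lt (fun _ => DF.var _) (fun _ => DF.var _) (DF.mul (DF.const _) (DF.var _)))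
      (DP.eqV (fun _ => DF.var _) (fun _ => DF.var _)))))
  · exact DP.allV (DP.imp (DP.closure (ZZ_def hX ι) fun _ => DF.var _) (DP.imp (DP.norm_le (fun _ => DF.var _) (fun _ => DF.var _) (DF.var _))
      (DP.mem (ZZ_def hX ι) fun _ => DF.var _)))

theorem ee_spec {n k : ℕ} {X Y : Set (Fin n → ℝ)} {ψ : (Fin n → ℝ) → ℝ} {ι : Fin k → Fin n} {z : Fin n → ℝ} {c : ℝ}
    (h : AA X Y ψ ι z c) : AA X Y ψ ι z (ee X Y ψ ι z) := by
  have hb : BddAbove {c | AA X Y ψ ι z c} := ⟨1, fun c hc => hc.2.1⟩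
  have h1 : c ≤ sSup {c | AA X Y ψ ι z c} := le_csSup hb h
  have h0 := h.1
  obtain ⟨c', hc', hlt⟩ := exists_lt_of_lt_csSup (s := {c | AA X Y ψ ι z c}) ⟨c, h⟩ (show ee X Y ψ ι z < _ by unfold ee; linarith)
  exact AA.mono hc' (by unfold ee; linarith) hlt.le

theorem AA_ex {n k p : ℕ} {X Y : Set (Fin n → ℝ)} {ψ : (Fin n → ℝ) → ℝ} {ι : Fin k → Fin n} {z : Fin n → ℝ}
    {e : (Fin n → ℝ) → ℝ} {τ : (Fin k → ℝ) → Fin n → ℝ} (hz : z ∈ ZZ X ι) (hs : NS p X ι e z τ)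
    (hlb : ∃ c : ℝ, 0 < c ∧ ∀ᶠ y in 𝓝 z, y ∈ Y → c ≤ ψ y) : ∃ c, AA X Y ψ ι z c := by
  obtain ⟨c1, hc1, h1⟩ := hlb
  obtain ⟨r1, hr1, h1⟩ := Metric.eventually_nhds_iff.1 h1
  obtain ⟨r2, hr2, h2⟩ := hz.2
  have h3 : ∀ᶠ x in 𝓝 z, (x ∈ X → x = τ (projc ι x)) ∧ (τ (projc ι x) ∈ ZZ X ι ∧ ContinuousAt τ (projc ι x)) :=
    hs.un.and (((projc_cont ι).continuousAt.tendsto.eventually hs.ev).mono fun x h => ⟨h.1, h.2.2⟩)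
  obtain ⟨r3, hr3, h3⟩ := Metric.eventually_nhds_iff.1 h3
  refine ⟨min (min 1 c1) (min r1 (min (r2/2) (r3/2))), ?_, ?_, ?_, ?_, ?_⟩
  · positivity
  · exact (min_le_left _ _).trans (min_le_left _ _)
  · intro x hx hd
    refine ((min_le_left _ _).trans (min_le_right _ _)).trans (h1 ?_ hx)
    rw [dist_eq_norm]
    exact hd.trans_le ((min_le_right _ _).trans (min_le_left _ _))
  · intro z' hz' hm hd
    refine h2 z' hz' hm (hd.trans_le ?_)
    have : min (min 1 c1) (min r1 (min (r2/2) (r3/2))) ≤ r2 / 2 := (min_le_right _ _).trans ((min_le_right _ _).trans (min_le_left _ _))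
    linarith
  · intro x hx hd
    have : min (min 1 c1) (min r1 (min (r2/2) (r3/2))) ≤ r3 / 2 := (min_le_right _ _).trans ((min_le_right _ _).trans (min_le_right _ _))
    have hxb : x ∈ Metric.ball z r3 := by
      rw [Metric.mem_ball, dist_eq_norm]; linarith
    have h4 := h3 (Metric.mem_ball.1 hxb)
    have hne : (𝓝[ZZ X ι] x).NeBot := mem_closure_iff_nhdsWithin_neBot.1 hx
    have hev : ∀ᶠ x' in 𝓝[ZZ X ι] x, x' = τ (projc ι x') := by
      filter_upwards [self_mem_nhdsWithin, mem_nhdsWithin_of_mem_nhds (Metric.isOpen_ball.mem_nhds hxb)] with x' h5 h6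
      exact (h3 (Metric.mem_ball.1 h6)).1 h5.1
    have ht1 : Tendsto (fun x' => τ (projc ι x')) (𝓝[ZZ X ι] x) (𝓝 (τ (projc ι x))) :=
      (ContinuousAt.comp (f := projc ι) h4.2.2 (projc_cont ι).continuousAt).tendsto.mono_left nhdsWithin_le_nhds
    have ht2 : Tendsto (fun x' => τ (projc ι x')) (𝓝[ZZ X ι] x) (𝓝 x) := by
      refine Tendsto.congr' (f₁ := fun x' => x') hev (tendsto_id.mono_left nhdsWithin_le_nhds)
    have := tendsto_nhds_unique ht2 ht1
    rw [this]; exact h4.2.1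

/-- `C^p` on a set -/
def CP {n : ℕ} (p : ℕ) (φ : (Fin n → ℝ) → ℝ) (Y : Set (Fin n → ℝ)) : Prop :=
  ∀ x ∈ Y, ∃ g : (Fin n → ℝ) → ℝ, ContDiffAt ℝ p g x ∧ ∀ᶠ y in 𝓝 x, y ∈ Y → φ y = g y

def GG (L : FirstOrder.Language) [L.Structure ℝ] {n : ℕ} (p : ℕ) (Y : Set (Fin n → ℝ)) (ψ : (Fin n → ℝ) → ℝ) : Prop :=
  ∃ φ, DF L φ ∧ CP p φ Y ∧ ∀ x ∈ Y, 0 < φ x ∧ φ x ≤ ψ x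

end glue1


section glue2
variable {L : FirstOrder.Language} [L.Structure ℝ] [DMin L]

theorem glue {n k p : ℕ} {X Y : Set (Fin n → ℝ)} (hX : IsDef L X) (hXY : X ⊆ Y)
    (hcl : ∀ x ∈ Y, x ∈ closure X → x ∈ X) {ψ : (Fin n → ℝ) → ℝ} (hY : IsDef L Y) (hψ : DF L ψ)
    (hlb : ∀ x ∈ Y, ∃ c : ℝ, 0 < c ∧ ∀ᶠ y in 𝓝 x, y ∈ Y → c ≤ ψ y) (ι : Fin k → Fin n)
    (hω : ∀ W : Set (Fin k → ℝ), IsClosed W → IsDef L W → ∃ ω : (Fin k → ℝ) → ℝ, DF L ω ∧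
      (∀ y, y ∉ W → ContDiffAt ℝ p ω y ∧ 0 < ω y ∧ ω y ≤ 1) ∧
      (Function.Injective (projc ι) ∨ ∀ y, y ∉ W → ∀ w ∈ W, ω y ≤ ‖y - w‖)) :
    ∃ X' : Set (Fin n → ℝ), X' ⊆ X ∧ IsDef L X' ∧ (∀ x ∈ Y, x ∈ closure X' → x ∈ X') ∧
      (∃ W : Set (Fin k → ℝ), IsClosed W ∧ IsDef L W ∧ interior W = ∅ ∧
        ∀ x ∈ X, projc ι x ∉ W → (x ∈ X' ↔ x ∉ ZZ X ι)) ∧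
      (GG L p (Y \ X) ψ → GG L p (Y \ X') ψ) := by
  set e := ee X Y ψ ι with he_def
  have he : DF L e := ee_def ι hX hY hψ
  obtain ⟨W, hWc, hWd, hWi, hW⟩ := regular p hX ι he
  obtain ⟨ω, hωd, hω1, hω2⟩ := hω W hWc hWd
  set Z : Set (Fin n → ℝ) := {x | x ∈ ZZ X ι ∧ projc ι x ∉ W} with hZ
  have hZd : IsDef L Z := DP.and (DP.mem (ZZ_def hX ι) fun _ => DF.var _) (DP.not (DP.mem hWd fun _ => DF.var _))
  have hZX : Z ⊆ X := fun x hx => hx.1.1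
  have hns : ∀ z ∈ Z, ∃ τ, NS p X ι e z τ := fun z hz => ns_of (hW z hz.1 hz.2)
  have hAA : ∀ z ∈ Z, AA X Y ψ ι z (e z) := by
    intro z hz
    obtain ⟨τ, hτ⟩ := hns z hz
    obtain ⟨c, hc⟩ := AA_ex hz.1 hτ (hlb z (hXY hz.1.1))
    exact ee_spec hc
  -- section values lie in Z
  have hτZ : ∀ z ∈ Z, ∀ τ, NS p X ι e z τ → ∀ᶠ y in 𝓝 (projc ι z), τ y ∈ Z ∧ projc ι (τ y) = y := by
    intro z hz τ hτ
    filter_upwards [hτ.ev, hWc.isOpen_compl.mem_nhds hz.2] with y h1 h2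
    exact ⟨⟨h1.1, by rw [h1.2.1]; exact h2⟩, h1.2.1⟩
  have hZo : ∀ z ∈ Z, ∀ᶠ x in 𝓝 z, x ∈ X → x ∈ Z := by
    intro z hz
    obtain ⟨τ, hτ⟩ := hns z hz
    filter_upwards [hτ.un, (projc_cont ι).continuousAt.tendsto.eventually (hτZ z hz τ hτ)] with x h1 h2 h3
    rw [h1 h3]; exact h2.1
  refine ⟨X \ Z, diff_subset, DP.and hX (DP.not hZd), ?_, ⟨W, hWc, hWd, hWi, ?_⟩, ?_⟩
  · intro x hxY hx
    have hxX := hcl x hxY (closure_mono diff_subset hx)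
    refine ⟨hxX, fun hxZ => ?_⟩
    obtain ⟨x', h1, h2⟩ := ((mem_closure_iff_frequently.1 hx).and_eventually (hZo x hxZ)).exists
    exact h1.2 (h2 h1.1)
  · intro x hxX hxW
    constructor
    · intro h h2; exact h.2 ⟨h2, hxW⟩
    · intro h; exact ⟨hxX, fun h2 => h h2.1⟩
  -- main construction
  set f : (Fin n → ℝ) → ℝ := fun z => e z * ω (projc ι z) with hf
  have hfd : DF L f := DF.mul he (hωd.comp fun _ => DF.var _)
  have hf0 : ∀ z ∈ Z, 0 < f z := fun z hz => mul_pos (hAA z hz).1 (hω1 _ hz.2).2.1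
  have hfe : ∀ z ∈ Z, f z ≤ e z := fun z hz => mul_le_of_le_one_right (hAA z hz).1.le (hω1 _ hz.2).2.2
  have hfω : ∀ z ∈ Z, f z ≤ ω (projc ι z) := fun z hz => mul_le_of_le_one_left (hω1 _ hz.2).2.1.le (hAA z hz).2.1
  -- f along sections
  have hfτ : ∀ z ∈ Z, ∀ τ, NS p X ι e z τ → ContDiffAt ℝ p (fun y => e (τ y) * ω y) (projc ι z) := 
    fun z hz τ hτ => hτ.ce.mul (hω1 _ hz.2).1
  set R : (Fin n → ℝ) → (Fin n → ℝ) → Prop := fun x z => z ∈ Z ∧ projc ι z = projc ι x ∧ qd x z < f z ^ 2 with hR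
  have hRd : ∀ {δ : Type} [Finite δ] (a b : (δ → ℝ) → Fin n → ℝ), (∀ j, DF L fun v => a v j) → (∀ j, DF L fun v => b v j) →
      DP L fun v => R (a v) (b v) := fun a b ha hb =>
    DP.and (DP.mem hZd hb) (DP.and (DP.eqV (fun j => hb _) (fun j => ha _)) (DP.lt (DF.qd ha hb) (DF.pow (hfd.comp hb) _)))
  have hRe : ∀ x z, R x z → ‖x - z‖ < e z := fun x z h => (qd_norm (hf0 z h.1) h.2.2).trans_le (hfe z h.1)
  have hRu : ∀ x z z', R x z → R x z' → z' = z := by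
    have key : ∀ x z z', R x z → R x z' → e z' ≤ e z → z' = z := by
      intro x z z' h h' hle
      refine (hAA z h.1).2.2.2.1 z' (hZX h'.1) (h'.2.1.trans h.2.1.symm) ?_
      have h1 := hRe x z h
      have h2 := hRe x z' h'
      have h3 : z' - z = (x - z) - (x - z') := by abel
      rw [h3]
      exact (norm_sub_le _ _).trans_lt (by linarith)
    intro x z z' h h'
    rcases le_total (e z') (e z) with hle | hle
    · exact key x z z' h h' hle
    · exact (key x z' z h' h hle).symm
  set ρ : (Fin n → ℝ) → Fin n → ℝ := fun x => uch (R x) with hρ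
  have hρd : ∀ j, DF L fun x => ρ x j := fun j => DF.uch (hRd _ _ (fun _ => DF.var _) fun _ => DF.var _) j
  have hρe : ∀ x z, R x z → ρ x = z := fun x z h => uch_eq h fun z' h' => hRu x z z' h h'
  have hRZ : ∀ z ∈ Z, R z z := fun z hz => ⟨hz, rfl, by rw [qd_self]; exact pow_pos (hf0 z hz) 2⟩
  rintro ⟨φ, hφd, hφC, hφ⟩
  set lam : (Fin n → ℝ) → ℝ := fun x => theta p (qd x (ρ x) / f (ρ x) ^ 2) with hlam
  set Φ : (Fin n → ℝ) → ℝ := fun x => if ∃ z, R x z then lam x * f (ρ x) + (1 - lam x) * φ x else φ x with hΦ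
  have hfρ : DF L fun x => f (ρ x) := hfd.comp hρd
  have hlamd : DF L lam := DF.theta p (DF.div (DF.qd (fun _ => DF.var _) hρd) (DF.pow hfρ _))
  refine ⟨Φ, ?_, ?_, ?_⟩
  · exact DF.ite (DP.exV (hRd _ _ (fun _ => DF.var _) fun _ => DF.var _))
      (DF.add (DF.mul hlamd hfρ) (DF.mul (DF.sub (DF.const _) hlamd) hφd)) hφd
  · -- smoothness
    intro x hx
    by_cases hxN : ∃ z, R x z
    · obtain ⟨z, hz⟩ := hxN
      obtain ⟨τ, hτ⟩ := hns z hz.1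
      have hpx : projc ι x = projc ι z := hz.2.1.symm
      have hτc : ContDiffAt ℝ p (fun x => τ (projc ι x)) x := by
        have h1 : ContDiffAt ℝ p τ (projc ι x) := by rw [hpx]; exact hτ.cd
        exact ContDiffAt.comp x h1 (projc_contDiff ι).contDiffAt
      set E : (Fin n → ℝ) → ℝ := fun x => e (τ (projc ι x)) * ω (projc ι x) with hE
      have hEc : ContDiffAt ℝ p E x := by
        have h1 : ContDiffAt ℝ p (fun y => e (τ y) * ω y) (projc ι x) := by rw [hpx]; exact hfτ z hz.1 τ hτ
        exact ContDiffAt.comp x h1 (projc_contDiff ι).contDiffAt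
      set Q : (Fin n → ℝ) → ℝ := fun x => qd x (τ (projc ι x)) with hQ
      have hQc : ContDiffAt ℝ p Q x := 
        ContDiffAt.comp x (g := fun v : (Fin n → ℝ) × (Fin n → ℝ) => qd v.1 v.2) (f := fun x => (x, τ (projc ι x)))
          qd_contDiff.contDiffAt (contDiffAt_id.prodMk hτc)
      have hτx : τ (projc ι x) = z := by rw [hpx, hτ.val]
      have hEx : E x = f z := by simp only [hE, hf, hpx, hτ.val]
      have hQx : Q x = qd x z := by simp only [hQ, hτx]
      have hev : ∀ᶠ x' in 𝓝 x, R x' (τ (projc ι x')) ∧ f (τ (projc ι x')) = E x' := by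
        have h1 : ∀ᶠ x' in 𝓝 x, τ (projc ι x') ∈ Z ∧ projc ι (τ (projc ι x')) = projc ι x' := by
          have := hτZ z hz.1 τ hτ
          rw [← hpx] at this
          exact (projc_cont ι).continuousAt.tendsto.eventually this
        have h2 : ∀ᶠ x' in 𝓝 x, Q x' < E x' ^ 2 := by
          refine hQc.continuousAt.eventually_lt (hEc.continuousAt.pow 2) ?_
          rw [hQx, hEx]; exact hz.2.2
        filter_upwards [h1, h2] with x' h3 h4
        have h5 : f (τ (projc ι x')) = E x' := by simp only [hf, hE, h3.2]
        exact ⟨⟨h3.1, h3.2, by rw [h5]; exact h4⟩, h5⟩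
      have hE0 : E x ≠ 0 := by rw [hEx]; exact (hf0 z hz.1).ne'
      have hLc : ContDiffAt ℝ p (fun x => theta p (Q x / E x ^ 2)) x :=
        (theta_contDiff p).contDiffAt.comp x (hQc.div (hEc.pow 2) (pow_ne_zero 2 hE0))
      have hev2 : ∀ᶠ x' in 𝓝 x, Φ x' = theta p (Q x' / E x' ^ 2) * E x' + (1 - theta p (Q x' / E x' ^ 2)) * φ x' := by
        filter_upwards [hev] with x' h
        have h1 : ρ x' = τ (projc ι x') := hρe _ _ h.1
        simp only [hΦ]
        rw [if_pos ⟨_, h.1⟩]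
        simp only [hlam, h1, h.2, hQ]
      by_cases hxX : x ∈ X
      · have hxZ : x ∈ Z := by
          by_contra h
          exact hx.2 ⟨hxX, h⟩
        have hzx : z = x := hRu x x z (hRZ x hxZ) hz
        refine ⟨E, hEc, ?_⟩
        have h1 : ∀ᶠ x' in 𝓝 x, Q x' / E x' ^ 2 < 1/4 := by
          refine (hQc.continuousAt.div (hEc.continuousAt.pow 2) (pow_ne_zero 2 hE0)).eventually_lt continuousAt_const ?_
          show Q x / E x ^ 2 < 1/4; rw [hQx, hzx, qd_self]; norm_num
        filter_upwards [hev2, h1] with x' h2 h3 _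
        rw [h2, theta_one p h3.le]; ring
      · obtain ⟨g, hg, hg2⟩ := hφC x ⟨hx.1, hxX⟩
        refine ⟨fun x' => theta p (Q x' / E x' ^ 2) * E x' + (1 - theta p (Q x' / E x' ^ 2)) * g x', (hLc.mul hEc).add ((contDiffAt_const.sub hLc).mul hg), ?_⟩
        have hnX : ∀ᶠ x' in 𝓝 x, x' ∉ X := by
          by_contra h
          exact hxX (hcl x hx.1 (mem_closure_iff_frequently.2 (by
            rw [Filter.not_eventually] at h; simpa using h)))
        filter_upwards [hev2, hg2, hnX] with x' h1 h2 h3 h4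
        rw [h1, h2 ⟨h4.1, h3⟩]
    · have hxX : x ∉ X := fun h => by
        have hxZ : x ∈ Z := by
          by_contra h'
          exact hx.2 ⟨h, h'⟩
        exact hxN ⟨x, hRZ x hxZ⟩
      have hxcl : x ∉ closure X := fun h => hxX (hcl x hx.1 h)
      have hnX : ∀ᶠ x' in 𝓝 x, x' ∉ X := by
        filter_upwards [isClosed_closure.isOpen_compl.mem_nhds hxcl] with x' h h'
        exact h (subset_closure h')
      have key : ∀ᶠ x' in 𝓝 x, ¬ ∃ z, R x' z ∧ qd x' z ≤ f z ^ 2 / 2 := by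
        by_contra hcon
        rw [Filter.not_eventually] at hcon
        simp only [not_not] at hcon
        obtain ⟨u, hu, hu2⟩ := exists_seq_forall_of_frequently hcon
        choose v hv hvq using hu2
        have hfb : ∀ j, f (v j) ∈ Icc (0:ℝ) 1 := fun j =>
          ⟨(hf0 _ (hv j).1).le, (hfe _ (hv j).1).trans (hAA _ (hv j).1).2.1⟩
        have hvb : ∀ j, ‖u j - v j‖ ≤ 1 := fun j => (hRe _ _ (hv j)).le.trans (hAA _ (hv j).1).2.1
        obtain ⟨B, hB⟩ := (Metric.isBounded_range_of_tendsto u hu).exists_norm_le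
        have hs : Bornology.IsBounded (Metric.closedBall (0 : Fin n → ℝ) (B + 1) ×ˢ Icc (0:ℝ) 1) :=
          Metric.isBounded_closedBall.prod (Metric.isBounded_Icc _ _)
        obtain ⟨⟨zs, l⟩, -, g, hg, hlim⟩ := tendsto_subseq_of_bounded hs (x := fun j => (v j, f (v j))) (by
          intro j
          refine ⟨?_, hfb j⟩
          rw [mem_closedBall_zero_iff]
          have h1 := hB (u j) (mem_range_self j)
          have h2 := hvb j
          have h3 : v j = u j - (u j - v j) := by abel
          rw [h3]
          exact (norm_sub_le _ _).trans (by linarith))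
        have hlz : Tendsto (fun j => v (g j)) atTop (𝓝 zs) := (continuous_fst.tendsto _).comp hlim
        have hll : Tendsto (fun j => f (v (g j))) atTop (𝓝 l) := (continuous_snd.tendsto _).comp hlim
        have hlu : Tendsto (fun j => u (g j)) atTop (𝓝 x) := hu.comp hg.tendsto_atTop
        have hl0 : 0 ≤ l := ge_of_tendsto' hll fun j => (hfb _).1
        have hqx : qd x zs ≤ l ^ 2 / 2 := by
          refine le_of_tendsto_of_tendsto' (((qd_cont (n := n)).tendsto (x, zs)).comp (hlu.prodMk_nhds hlz)) ((hll.pow 2).div_const 2) fun j => hvq _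
        have hpz : projc ι zs = projc ι x := by
          refine tendsto_nhds_unique (((projc_cont ι).tendsto _).comp hlz) ?_
          refine (((projc_cont ι).tendsto _).comp hlu).congr fun j => ?_
          exact (hv (g j)).2.1.symm
        have hzcl : zs ∈ closure Z := mem_closure_of_tendsto hlz (Eventually.of_forall fun j => (hv _).1)
        rcases hl0.eq_or_lt with hl | hl
        · rw [← hl] at hqx
          have : x = zs := qd_zero (by simpa using hqx)
          exact hxcl (this ▸ closure_mono hZX hzcl)
        · rcases hω2 with hinj | hω2
          · refine hxcl (mem_closure_of_tendsto hu (Eventually.of_forall fun j => ?_))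
            have : v j = u j := hinj (hv j).2.1
            rw [← this]; exact hZX (hv j).1
          · have hxW : projc ι x ∉ W := by
              intro hxW
              have h1 : Tendsto (fun j => ‖projc ι (v (g j)) - projc ι x‖) atTop (𝓝 0) := by
                have := (((projc_cont ι).tendsto _).comp hlz)
                rw [hpz] at this
                simpa using (this.sub_const (projc ι x)).norm
              have := le_of_tendsto_of_tendsto' hll h1 fun j => (hfω _ (hv _).1).trans (hω2 _ (hv _).1.2 _ hxW)
              linarith
            have hzZ0 : zs ∈ ZZ X ι := by
              have h1 : Tendsto (fun j => ‖zs - v (g j)‖) atTop (𝓝 0) := by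
                simpa using (hlz.const_sub zs).norm
              obtain ⟨j, hj⟩ := (h1.eventually_lt hll hl).exists
              exact (hAA _ (hv (g j)).1).2.2.2.2 zs (closure_mono (fun z hz => hz.1) hzcl) (hj.le.trans (hfe _ (hv _).1))
            have hzZ : zs ∈ Z := ⟨hzZ0, by rw [hpz]; exact hxW⟩
            obtain ⟨τ, hτ⟩ := hns zs hzZ
            have hlf : l = f zs := by
              refine tendsto_nhds_unique hll ?_
              have h1 : Tendsto (fun j => e (τ (projc ι (v (g j)))) * ω (projc ι (v (g j)))) atTop (𝓝 (e (τ (projc ι zs)) * ω (projc ι zs))) :=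
                (hfτ zs hzZ τ hτ).continuousAt.tendsto.comp (((projc_cont ι).tendsto _).comp hlz)
              rw [hτ.val] at h1
              refine h1.congr' ?_
              filter_upwards [hlz.eventually hτ.un] with j hj
              rw [← hj (hZX (hv _).1)]
            refine hxN ⟨zs, hzZ, hpz, ?_⟩
            rw [← hlf]
            have : 0 < l ^ 2 := by positivity
            linarith
      obtain ⟨g, hg, hg2⟩ := hφC x ⟨hx.1, hxX⟩
      refine ⟨g, hg, ?_⟩
      filter_upwards [key, hg2, hnX] with x' h1 h2 h3 h4
      rw [← h2 ⟨h4.1, h3⟩]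
      simp only [hΦ]
      split_ifs with h5
      · obtain ⟨z, hz⟩ := h5
        have h6 : ρ x' = z := hρe _ _ hz
        have h7 : lam x' = 0 := by
          simp only [hlam, h6]
          apply theta_zero
          have h8 := hf0 z hz.1
          rw [le_div_iff₀ (by positivity)]
          by_contra h9
          exact h1 ⟨z, hz, by linarith⟩
        rw [h7]; ring
      · rfl
  · intro x hx
    simp only [hΦ]
    split_ifs with h5
    · obtain ⟨z, hz⟩ := h5
      have h6 : ρ x = z := hρe _ _ hz
      have hfx : f (ρ x) ≤ ψ x := by
        rw [h6]
        exact (hfe z hz.1).trans ((hAA z hz.1).2.2.1 x hx.1 (hRe x z hz))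
      have hfp : 0 < f (ρ x) := by rw [h6]; exact hf0 z hz.1
      by_cases hxX : x ∈ X
      · have hxZ : x ∈ Z := by
          by_contra h
          exact hx.2 ⟨hxX, h⟩
        have h7 : lam x = 1 := by
          simp only [hlam, hρe x x (hRZ x hxZ), qd_self, zero_div]
          exact theta_one p (by norm_num)
        rw [h7]
        constructor <;> simp only [one_mul, sub_self, zero_mul, add_zero] <;> assumption
      · obtain ⟨h8, h9⟩ := hφ x ⟨hx.1, hxX⟩
        have h10 : 0 ≤ lam x := theta_nonneg _ _
        have h11 : lam x ≤ 1 := theta_le_one _ _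
        constructor
        · rcases h10.eq_or_lt with h | h
          · rw [← h]; linarith
          · have := mul_pos h hfp
            have := mul_nonneg (sub_nonneg.2 h11) h8.le
            linarith
        · nlinarith
    · refine hφ x ⟨hx.1, fun hxX => ?_⟩
      have hxZ : x ∈ Z := by
        by_contra h
        exact hx.2 ⟨hxX, h⟩
      exact h5 ⟨x, hRZ x hxZ⟩

end glue2


section peel1
variable {L : FirstOrder.Language} [L.Structure ℝ] [DMin L]

theorem disc_pi {n : ℕ} {D : Fin n → Set ℝ} (h : ∀ j, Disc (D j)) : Disc {x : Fin n → ℝ | ∀ j, x j ∈ D j} := by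
  intro x hx
  have h1 : ∀ j, ∀ᶠ x' : Fin n → ℝ in 𝓝 x, x' j ∈ D j → x' j = x j := by
    intro j
    obtain ⟨r, hr, h2⟩ := h j (x j) (hx j)
    have : ∀ᶠ t in 𝓝 (x j), t ∈ D j → t = x j :=
      Metric.eventually_nhds_iff.2 ⟨r, hr, fun t ht htD => h2 t htD ht⟩
    exact (continuous_apply j).continuousAt.tendsto.eventually this
  obtain ⟨r, hr, h3⟩ := Metric.eventually_nhds_iff.1 (eventually_all.2 h1)
  exact ⟨r, hr, fun x' hx' hd => funext fun j => h3 hd j (hx' j)⟩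

theorem fib_bound {n k : ℕ} {X : Set (Fin n → ℝ)} (hX : IsDef L X) (ι : Fin k → Fin n)
    (hdim : ∀ j : Fin n, j ∉ range ι → interior (projc (Fin.cons j ι : Fin (k+1) → Fin n) '' X) = ∅) :
    ∃ (N : ℕ) (W : Set (Fin k → ℝ)), IsClosed W ∧ interior W = ∅ ∧
      ∀ y, y ∉ W → dset^[N] {x | x ∈ X ∧ projc ι x = y} = ∅ := by
  set S : Fin n → (Fin k → ℝ) → ℝ → Prop := fun j y t => ∃ x : Fin n → ℝ, x ∈ X ∧ projc ι x = y ∧ x j = t with hS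
  have hSd : ∀ j, DP L fun w : Fin k ⊕ Unit → ℝ => S j (fun i => w (Sum.inl i)) (w (Sum.inr ())) := fun j =>
    DP.exV (DP.and (DP.mem hX fun _ => DF.var _) (DP.and (DP.eqV (fun _ => DF.var _) (fun _ => DF.var _))
      (DP.eq (DF.var _) (DF.var _))))
  choose N U D hU hD e using fun j => fam_dmin (hSd j)
  set Bad : (Fin k → ℝ) → Prop := fun y => ∃ j, ∃ a b : ℝ, a < b ∧ ∀ t, a < t → t < b → S j y t with hBad
  have hBd : DP L Bad := by
    refine DP.exF fun j => DP.ex (DP.ex (DP.and (DP.lt (DF.var _) (DF.var _)) (DP.all (DP.imp (DP.lt (DF.var _) (DF.var _)) (DP.imp (DP.lt (DF.var _) (DF.var _)) ?_)))))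
    exact DP.comp (hSd j) (f := fun w => Sum.elim (fun i => w (Sum.inl (Sum.inl (Sum.inl i)))) (fun _ => w (Sum.inr ())))
      (by rintro (i | i) <;> exact DF.var _)
  have hBi : interior {y | Bad y} = ∅ := by
    by_contra hne
    rw [← ne_eq, ← nonempty_iff_ne_empty] at hne
    obtain ⟨⟨j, q, q'⟩, y0, hy0, -⟩ := baireD (L := L) (ι := Fin n × ℚ × ℚ) isOpen_interior hne
      (fun i y => (i.2.1 : ℝ) < i.2.2 ∧ ∀ t : ℝ, (i.2.1 : ℝ) < t → t < i.2.2 → S i.1 y t)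
      (fun i => DP.and (DP.const _) (DP.all (DP.imp (DP.lt (DF.const _) (DF.var _)) (DP.imp (DP.lt (DF.var _) (DF.const _)) (hSd i.1)))))
      (by
        intro y hy
        obtain ⟨j, a, b, hab, h⟩ := interior_subset hy
        obtain ⟨q, hq1, hq2⟩ := exists_rat_btwn hab
        obtain ⟨q', hq3, hq4⟩ := exists_rat_btwn hq2
        exact mem_iUnion.2 ⟨⟨j, q, q'⟩, hq3, fun t h1 h2 => h t (hq1.trans h1) (h2.trans hq4)⟩)
    have hy1 := interior_subset hy0
    simp only [mem_setOf_eq] at hy1 hy0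
    obtain ⟨q'', h1, h2⟩ := exists_between hy1.1
    by_cases hj : j ∈ range ι
    · obtain ⟨i, rfl⟩ := hj
      obtain ⟨q3, h3, h4⟩ := exists_between h2
      obtain ⟨x, -, hx, hx2⟩ := hy1.2 q'' h1 h2
      obtain ⟨x', -, hx', hx2'⟩ := hy1.2 q3 (h1.trans h3) h4
      have := congrFun (hx.trans hx'.symm) i
      simp only [projc] at this
      rw [hx2, hx2'] at this
      exact h3.ne this
    · have hE := hdim j hj
      have : (Fin.cons q'' y0 : Fin (k+1) → ℝ) ∈ interior (projc (Fin.cons j ι : Fin (k+1) → Fin n) '' X) := by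
        rw [mem_interior]
        refine ⟨{v | v 0 ∈ Ioo (q:ℝ) q' ∧ (fun i : Fin k => v i.succ) ∈ interior {y | (q:ℝ) < q' ∧ ∀ t : ℝ, (q : ℝ) < t → t < q' → S j y t}}, ?_, ?_, ?_⟩
        · rintro v ⟨hv1, hv2⟩
          obtain ⟨x, hx1, hx2, hx3⟩ := (interior_subset hv2).2 (v 0) hv1.1 hv1.2
          refine ⟨x, hx1, ?_⟩
          funext i
          refine Fin.cases ?_ (fun i => ?_) i
          · simpa [projc] using hx3
          · simpa [projc] using congrFun hx2 i
        · exact (isOpen_Ioo.preimage (continuous_apply 0)).inter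
            (isOpen_interior.preimage (continuous_pi fun i => continuous_apply _))
        · exact ⟨by simpa using ⟨h1, h2⟩, by simpa using hy0⟩
      rw [hE] at this
      exact this
  refine ⟨Fintype.card (∀ j, Fin (N j)), closure {y | Bad y}, isClosed_closure, ?_, ?_⟩
  · by_contra hne
    rw [← ne_eq, ← nonempty_iff_ne_empty] at hne
    obtain ⟨y, hy, -⟩ := idense (L := L) k hBd isOpen_interior hne interior_subset
    rw [hBi] at hy; exact hy
  · intro y hy
    have hy : ¬ Bad y := fun h => hy (subset_closure h)
    have hUe : ∀ j, U j y = ∅ := by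
      intro j
      by_contra hne
      rw [← ne_eq, ← nonempty_iff_ne_empty] at hne
      obtain ⟨t, ht⟩ := hne
      obtain ⟨r, hr, hs⟩ := Metric.isOpen_iff.1 (hU j y) t ht
      rw [Real.ball_eq_Ioo] at hs
      refine hy ⟨j, t - r, t + r, by linarith, fun s h1 h2 => ?_⟩
      have : s ∈ {t | S j y t} := by rw [e j y]; exact Or.inl (hs ⟨h1, h2⟩)
      exact this
    refine dset_iter_empty _ _ (fun i => {x | ∀ j, x j ∈ D j y ((Fintype.equivFin (∀ j, Fin (N j))).symm i j)})
      (fun i => disc_pi fun j => hD _ _ _) ?_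
    rintro x ⟨hx, hxy⟩
    have h1 : ∀ j, ∃ i, x j ∈ D j y i := by
      intro j
      have : x j ∈ {t | S j y t} := ⟨x, hx, hxy, rfl⟩
      rw [e j y, hUe, empty_union, mem_iUnion] at this
      exact this
    choose f hf using h1
    exact mem_iUnion.2 ⟨Fintype.equivFin _ f, fun j => by simpa using hf j⟩

end peel1


section peel2
variable {L : FirstOrder.Language} [L.Structure ℝ] [DMin L]

def Good (L : FirstOrder.Language) [L.Structure ℝ] {n : ℕ} (Y X : Set (Fin n → ℝ)) : Prop :=
  IsDef L X ∧ X ⊆ Y ∧ ∀ x ∈ Y, x ∈ closure X → x ∈ X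

def OM (L : FirstOrder.Language) [L.Structure ℝ] {n k : ℕ} (p : ℕ) (ι : Fin k → Fin n) : Prop :=
  ∀ W : Set (Fin k → ℝ), IsClosed W → IsDef L W → ∃ ω : (Fin k → ℝ) → ℝ, DF L ω ∧
    (∀ y, y ∉ W → ContDiffAt ℝ p ω y ∧ 0 < ω y ∧ ω y ≤ 1) ∧
    (Function.Injective (projc ι) ∨ ∀ y, y ∉ W → ∀ w ∈ W, ω y ≤ ‖y - w‖)

def dimLT {n : ℕ} (X : Set (Fin n → ℝ)) (k : ℕ) : Prop :=
  ∀ ι : Fin k → Fin n, Function.Injective ι → interior (projc ι '' X) = ∅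

theorem int_mono {E : Type*} [TopologicalSpace E] {A B : Set E} (h : A ⊆ B) (hB : interior B = ∅) : interior A = ∅ :=
  subset_empty_iff.1 (hB ▸ interior_mono h)

theorem peelN {n k p : ℕ} {Y : Set (Fin n → ℝ)} {ψ : (Fin n → ℝ) → ℝ} (hY : IsDef L Y) (hψ : DF L ψ)
    (hlb : ∀ x ∈ Y, ∃ c : ℝ, 0 < c ∧ ∀ᶠ y in 𝓝 x, y ∈ Y → c ≤ ψ y) (ι : Fin k → Fin n) (hω : OM L p ι) (N : ℕ) :
    ∀ X, Good L Y X → ∀ W' : Set (Fin k → ℝ), IsClosed W' → interior W' = ∅ →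
      (∀ y, y ∉ W' → dset^[N] {x | x ∈ X ∧ projc ι x = y} = ∅) →
      ∃ X', Good L Y X' ∧ X' ⊆ X ∧ interior (projc ι '' X') = ∅ ∧ (GG L p (Y \ X) ψ → GG L p (Y \ X') ψ) := by
  induction N with
  | zero =>
    intro X hX W' hc hi h
    refine ⟨X, hX, subset_rfl, int_mono ?_ hi, id⟩
    rintro _ ⟨x, hx, rfl⟩
    by_contra hn
    have : x ∈ dset^[0] {x' | x' ∈ X ∧ projc ι x' = projc ι x} := ⟨hx, rfl⟩
    rw [h _ hn] at this
    exact this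
  | succ N ih =>
    intro X hX W' hc hi h
    obtain ⟨X1, h1, h2, h3, ⟨W, hW1, -, hW2, hW3⟩, h4⟩ := glue hX.1 hX.2.1 hX.2.2 hY hψ hlb ι hω
    obtain ⟨X', h5, h6, h7, h8⟩ := ih X1 ⟨h2, h1.trans hX.2.1, h3⟩ (W ∪ W') (hW1.union hc)
      (by rw [interior_union_isClosed_of_interior_empty hW1 hi, hW2]) (by
        intro y hy
        have hyW : y ∉ W := fun h => hy (Or.inl h)
        have e : {x | x ∈ X1 ∧ projc ι x = y} = dset {x | x ∈ X ∧ projc ι x = y} := by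
          ext x
          constructor
          · rintro ⟨hx, rfl⟩
            have hxX := h1 hx
            refine ⟨⟨hxX, rfl⟩, fun r hr => ?_⟩
            have hZ := (hW3 x hxX hyW).1 hx
            by_contra hn
            push Not at hn
            refine hZ ⟨hxX, r, hr, fun x' hx' hp hd => ?_⟩
            by_contra hne
            have := hn x' ⟨hx', hp⟩ hne
            rw [dist_eq_norm] at this
            linarith
          · rintro ⟨⟨hxX, rfl⟩, hx⟩
            refine ⟨(hW3 x hxX hyW).2 ?_, rfl⟩
            rintro ⟨-, r, hr, hZ⟩
            obtain ⟨x', hx', hne, hd⟩ := hx r hr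
            exact hne (hZ x' hx'.1 hx'.2 (by rwa [dist_eq_norm] at hd))
        rw [e, ← Function.iterate_succ_apply]
        exact h y fun h => hy (Or.inr h))
    exact ⟨X', h5, h6.trans h1, h7, h8 ∘ h4⟩

theorem peelT {n k p : ℕ} {Y : Set (Fin n → ℝ)} {ψ : (Fin n → ℝ) → ℝ} (hY : IsDef L Y) (hψ : DF L ψ)
    (hlb : ∀ x ∈ Y, ∃ c : ℝ, 0 < c ∧ ∀ᶠ y in 𝓝 x, y ∈ Y → c ≤ ψ y)
    (hω : ∀ ι : Fin k → Fin n, Function.Injective ι → OM L p ι) (T : Finset (Fin k → Fin n)) :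
    ∀ X, Good L Y X → dimLT X (k+1) → (∀ ι : Fin k → Fin n, Function.Injective ι → ι ∉ T → interior (projc ι '' X) = ∅) →
      ∃ X', Good L Y X' ∧ dimLT X' k ∧ (GG L p (Y \ X) ψ → GG L p (Y \ X') ψ) := by
  induction T using Finset.induction_on with
  | empty => exact fun X hX hd h => ⟨X, hX, fun ι hι => h ι hι (by simp), id⟩
  | insert ι T hT ih =>
    intro X hX hd h
    by_cases hι : Function.Injective ι
    · obtain ⟨N, W, h1, h2, h3⟩ := fib_bound hX.1 ι (fun j hj => hd _ (Fin.cons_injective_iff.2 ⟨hj, hι⟩))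
      obtain ⟨X1, h4, h5, h6, h7⟩ := peelN hY hψ hlb ι (hω ι hι) N X hX W h1 h2 h3
      obtain ⟨X', h8, h9, h10⟩ := ih X1 h4 (fun κ hκ => int_mono (image_mono h5) (hd κ hκ)) (fun κ hκ hκT => by
        by_cases e : κ = ι
        · rw [e]; exact h6
        · exact int_mono (image_mono h5) (h κ hκ (by simp [e, hκT])))
      exact ⟨X', h8, h9, h10 ∘ h7⟩
    · exact ih X hX hd fun κ hκ hκT => h κ hκ (by
        rw [Finset.mem_insert, not_or]
        exact ⟨fun e => hι (e ▸ hκ), hκT⟩)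

theorem peelK {n p : ℕ} {Y : Set (Fin n → ℝ)} {ψ : (Fin n → ℝ) → ℝ} (hY : IsDef L Y) (hψ : DF L ψ)
    (hlb : ∀ x ∈ Y, ∃ c : ℝ, 0 < c ∧ ∀ᶠ y in 𝓝 x, y ∈ Y → c ≤ ψ y)
    (hω : ∀ k, ∀ ι : Fin k → Fin n, Function.Injective ι → OM L p ι) (k : ℕ) :
    ∀ X, Good L Y X → dimLT X k → GG L p (Y \ X) ψ → GG L p Y ψ := by
  induction k with
  | zero =>
    intro X hX hd h
    have h1 := hd Fin.elim0 (fun i => i.elim0)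
    have : X = ∅ := by
      by_contra hne
      rw [← ne_eq, ← nonempty_iff_ne_empty] at hne
      have h2 : (projc (Fin.elim0 : Fin 0 → Fin n) '' X) = univ :=
        Subsingleton.eq_univ_of_nonempty (hne.image _)
      rw [h2, interior_univ] at h1
      exact univ_nonempty.ne_empty h1
    simpa [this] using h
  | succ k ih =>
    intro X hX hd h
    obtain ⟨X', h1, h2, h3⟩ := peelT hY hψ hlb (hω k) Finset.univ X hX hd (fun ι _ h => absurd (Finset.mem_univ _) h)
    exact ih X' h1 h2 (h3 h)

theorem main_claim (p : ℕ) : ∀ (n : ℕ) {Y : Set (Fin n → ℝ)} {ψ : (Fin n → ℝ) → ℝ}, IsDef L Y → DF L ψ →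
    (∀ x ∈ Y, ∃ c : ℝ, 0 < c ∧ ∀ᶠ y in 𝓝 x, y ∈ Y → c ≤ ψ y) → GG L p Y ψ := by
  intro n
  induction n using Nat.strong_induction_on with
  | _ n ih =>
  intro Y ψ hY hψ hlb
  refine peelK hY hψ hlb ?_ (n+1) Y ⟨hY, subset_rfl, fun x h _ => h⟩ ?_ ?_
  · intro k ι hι W hWc hWd
    rcases lt_or_ge k n with hk | hk
    · set δ : (Fin k → ℝ) → ℝ := fun y => sSup {t | t ≤ 1 ∧ ∀ w : Fin k → ℝ, w ∈ W → t ≤ ‖y - w‖} with hδ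
      have hδd : DF L δ := by
        refine DF.sSup (DP.and (DP.le (DF.var _) (DF.const _)) (DP.allV (DP.imp (DP.mem hWd fun _ => DF.var _) ?_)))
        refine (DP.norm_lt (k := k) (f := fun v : (Fin k ⊕ Unit) ⊕ Fin k → ℝ => fun i => v (Sum.inl (Sum.inl i))) (g := fun v => fun j => v (Sum.inr j)) (r := fun v => v (Sum.inl (Sum.inr ()))) (fun _ => DF.var _) (fun _ => DF.var _) (DF.var _)).not.congr fun v => ?_
        exact not_lt
      have hb : ∀ y, BddAbove {t : ℝ | t ≤ 1 ∧ ∀ w : Fin k → ℝ, w ∈ W → t ≤ ‖y - w‖} := fun y => ⟨1, fun t h => h.1⟩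
      have hne : ∀ y, {t : ℝ | t ≤ 1 ∧ ∀ w : Fin k → ℝ, w ∈ W → t ≤ ‖y - w‖}.Nonempty :=
        fun y => ⟨0, zero_le_one, fun w _ => norm_nonneg _⟩
      obtain ⟨ω, h1, h2, h3⟩ := ih k hk (Y := Wᶜ) (ψ := δ) (DP.not hWd) hδd (by
        intro y hy
        obtain ⟨r, hr, hs⟩ := Metric.isOpen_iff.1 hWc.isOpen_compl y hy
        refine ⟨min 1 (r/2), by positivity, ?_⟩
        filter_upwards [Metric.ball_mem_nhds y (half_pos hr)] with y' hy' _
        refine le_csSup (hb y') ⟨min_le_left _ _, fun w hw => (min_le_right _ _).trans ?_⟩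
        by_contra hlt
        push Not at hlt
        suffices hwb : w ∈ Metric.ball y r
          from hs hwb hw
        rw [Metric.mem_ball] at hy' ⊢
        rw [← dist_eq_norm, dist_comm] at hlt
        linarith [dist_triangle w y' y])
      refine ⟨ω, h1, fun y hy => ⟨?_, (h3 y hy).1, (h3 y hy).2.trans (csSup_le (hne y) fun t h => h.1)⟩, Or.inr fun y hy w hw => (h3 y hy).2.trans (csSup_le (hne y) fun t h => h.2 w hw)⟩
      obtain ⟨g, hg, hg2⟩ := h2 y hy
      refine hg.congr_of_eventuallyEq ?_
      filter_upwards [hg2, hWc.isOpen_compl.mem_nhds hy] with y' h h' using h h'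
    · have hs : Function.Surjective ι := by
        have : k = n := le_antisymm (by simpa using Fintype.card_le_of_injective ι hι) hk
        subst this
        exact Finite.surjective_of_injective hι
      refine ⟨fun _ => 1, DF.const 1, fun y _ => ⟨contDiffAt_const, one_pos, le_rfl⟩, Or.inl ?_⟩
      intro x x' h
      funext j
      obtain ⟨i, rfl⟩ := hs j
      exact congrFun h i
  · intro ι hι
    have := Fintype.card_le_of_injective ι hι
    simp at this
  · refine ⟨fun _ => 1, DF.const 1, ?_, ?_⟩
    · intro x hx; simp at hx
    · intro x hx; simp at hx

end peel2


/-- minorization by a positive definable `C^p` function. -/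
theorem stmt11 (L : FirstOrder.Language) [L.Structure ℝ] (hL : DMinimal L) (p n d : ℕ)
    (M : Set (Fin n → ℝ)) (hM : IsDpSubmanifold L p d M)
    (ψ : (Fin n → ℝ) → ℝ) (hψdef : IsDefFunOn L M ψ) (hψpos : ∀ x ∈ M, 0 < ψ x)
    (hlb : ∀ x ∈ M, ∃ (U : Set (Fin n → ℝ)) (cx : ℝ), IsOpen U ∧ x ∈ U ∧ 0 < cx ∧
      ∀ y ∈ M ∩ U, cx < ψ y) :
    ∃ φ : (Fin n → ℝ) → ℝ, IsDefFunOn L M φ ∧ CpOn p φ M ∧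
      (∀ x ∈ M, 0 < φ x) ∧ ∀ x ∈ M, φ x ≤ ψ x := by
  haveI : DMin L := ⟨hL⟩
  have hψ' : DF L fun x => if x ∈ M then ψ x else 0 := by
    refine DF.of (DP.congr (DP.or (P := fun w : Fin n ⊕ Unit → ℝ => (fun i => w (Sum.inl i)) ∈ M ∧ w (Sum.inr ()) = ψ (fun i => w (Sum.inl i)))
      hψdef (DP.and (DP.not (DP.mem hM.1 (f := fun (w : Fin n ⊕ Unit → ℝ) i => w (Sum.inl i)) fun _ => DF.var _)) (DP.eq (DF.var (Sum.inr ())) (DF.const 0)))) fun v => ?_)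
    by_cases h : (fun i => v (Sum.inl i)) ∈ M <;> simp [h]
  obtain ⟨φ, h1, h2, h3⟩ := main_claim (L := L) p n hM.1 hψ' (by
    intro x hx
    obtain ⟨U, c, hU, hxU, hc, h⟩ := hlb x hx
    refine ⟨c, hc, ?_⟩
    filter_upwards [hU.mem_nhds hxU] with y hy hyM
    rw [if_pos hyM]
    exact (h y ⟨hyM, hy⟩).le)
  refine ⟨φ, ?_, ?_, fun x hx => (h3 x hx).1, fun x hx => by simpa [hx] using (h3 x hx).2⟩
  · exact DP.and (DP.mem hM.1 (f := fun (w : Fin n ⊕ Unit → ℝ) i => w (Sum.inl i)) fun _ => DF.var _) h1.graph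
  · intro x hx
    obtain ⟨g, hg, hg2⟩ := h2 x hx
    obtain ⟨u, hu, hgu⟩ := hg.contDiffOn le_rfl (by simp)
    obtain ⟨U, hUs, hU, hxU⟩ := mem_nhds_iff.1 (Filter.inter_mem hu hg2)
    exact ⟨U, g, hU, hxU, hgu.mono fun y hy => (hUs hy).1, fun y hy => (hUs hy.2).2 hy.1⟩

end DMinPaper
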